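/- arXiv:2104.12172 — 5 statements merged into one kernel-verified Lean document; each statement's English description precedes it below -/
import Mathlib

section
/- Every convex pentagon contains a convex quadrilateral whose vertices are four of the pentagon's vertices and whose area is at least (5+√5)/10 times the area of the pentagon. -/
open MeasureTheory

/-- The area of a planar point set: the Lebesgue measure of its convex hull. -/
noncomputable def area (S : Set (ℝ × ℝ)) : ℝ :=
  (volume (convexHull ℝ S)).toReal

/-- Points in strictly convex position, affinely spanning the plane. -/
def StrictConvexPos {n : ℕ} (p : Fin n → ℝ × ℝ) : Prop :=
  (∀ i : Fin n, p i ∉ convexHull ℝ (p '' {j | j ≠ i})) ∧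
    affineSpan ℝ (Set.range p) = ⊤

/-- Twice the signed area of the triangle `a b c`. -/
def cross (a b c : ℝ × ℝ) : ℝ :=
  (b.1 - a.1) * (c.2 - a.2) - (b.2 - a.2) * (c.1 - a.1)

theorem Convex.triple_mem {s : Set (ℝ × ℝ)} (hs : Convex ℝ s) {a b c : ℝ × ℝ}
    (ha : a ∈ s) (hb : b ∈ s) (hc : c ∈ s) {u v w : ℝ} (hu : 0 ≤ u) (hv : 0 ≤ v) (hw : 0 ≤ w)
    (h : u + v + w = 1) : u • a + v • b + w • c ∈ s := by
  have := hs.sum_mem (t := Finset.univ) (w := ![u, v, w]) (z := ![a, b, c])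
    (by intro i _; fin_cases i <;> simpa)
    (by simpa [Fin.sum_univ_three] using h) (by intro i _; fin_cases i <;> simpa)
  simpa [Fin.sum_univ_three] using this

theorem mem_convexHull_of_cross_nonneg {a b c x : ℝ × ℝ} (h : 0 < cross a b c)
    (h₁ : 0 ≤ cross a b x) (h₂ : 0 ≤ cross b c x) (h₃ : 0 ≤ cross c a x) :
    x ∈ convexHull ℝ {a, b, c} := by
  have hsum : cross b c x + cross c a x + cross a b x = cross a b c := by
    simp only [cross]; ring
  have hx : x = (cross b c x / cross a b c) • a + (cross c a x / cross a b c) • b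
      + (cross a b x / cross a b c) • c := by
    ext <;> simp only [Prod.fst_add, Prod.snd_add, Prod.smul_fst, Prod.smul_snd, smul_eq_mul] <;>
      field_simp <;> simp only [cross] <;> ring
  rw [hx]
  have hsub := subset_convexHull ℝ ({a, b, c} : Set (ℝ × ℝ))
  refine (convex_convexHull ℝ _).triple_mem (hsub (by simp)) (hsub (by simp)) (hsub (by simp))
    (by positivity) (by positivity) (by positivity) ?_
  rw [← add_div, ← add_div, hsum, div_self h.ne']

theorem convex_setOf_cross_nonneg (a b : ℝ × ℝ) : Convex ℝ {x | 0 ≤ cross a b x} := by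
  intro x hx y hy u v hu hv huv
  simp only [Set.mem_ofPred_eq] at *
  have : cross a b (u • x + v • y) = u * cross a b x + v * cross a b y := by
    obtain rfl : v = 1 - u := by linarith
    simp only [cross, Prod.fst_add, Prod.snd_add, Prod.smul_fst, Prod.smul_snd, smul_eq_mul]
    ring
  rw [this]
  positivity

theorem cross_nonneg_of_mem_convexHull {a b x : ℝ × ℝ} {s : Set (ℝ × ℝ)}
    (hs : ∀ y ∈ s, 0 ≤ cross a b y) (hx : x ∈ convexHull ℝ s) : 0 ≤ cross a b x :=
  convexHull_min (t := {x | 0 ≤ cross a b x}) hs (convex_setOf_cross_nonneg a b) hx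

theorem volume_setOf_cross_eq_zero {a b : ℝ × ℝ} (hab : a ≠ b) :
    volume {x | cross a b x = 0} = 0 := by
  let f : ℝ × ℝ →ₗ[ℝ] ℝ :=
    (b.1 - a.1) • LinearMap.snd ℝ ℝ ℝ - (b.2 - a.2) • LinearMap.fst ℝ ℝ ℝ
  have hf : ∀ x, f x = (b.1 - a.1) * x.2 - (b.2 - a.2) * x.1 := fun x => rfl
  have hset : {x | cross a b x = 0} = (fun x => -a + x) ⁻¹' (LinearMap.ker f : Set (ℝ × ℝ)) := by
    ext x
    simp only [Set.mem_ofPred_eq, Set.mem_preimage, SetLike.mem_coe, LinearMap.mem_ker, hf, cross,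
      Prod.fst_add, Prod.snd_add, Prod.fst_neg, Prod.snd_neg]
    constructor <;> intro h <;> linarith
  rw [hset, measure_preimage_add]
  refine Measure.addHaar_submodule _ _ fun htop => hab ?_
  rw [LinearMap.ker_eq_top] at htop
  have h₁ := LinearMap.congr_fun htop (1, 0)
  have h₂ := LinearMap.congr_fun htop (0, 1)
  simp only [hf, LinearMap.zero_apply] at h₁ h₂
  ext <;> linarith

open scoped Pointwise in
theorem area_triangle (a b c : ℝ × ℝ) :
    area {a, b, c} = |cross a b c| * area {(0, 0), (1, 0), (0, 1)} := by
  let f : ℝ × ℝ →ₗ[ℝ] ℝ × ℝ :=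
    Matrix.toLin (Module.Basis.finTwoProd ℝ) (Module.Basis.finTwoProd ℝ)
      !![b.1 - a.1, c.1 - a.1; b.2 - a.2, c.2 - a.2]
  have hf : ∀ x, f x = ((b.1 - a.1) * x.1 + (c.1 - a.1) * x.2,
      (b.2 - a.2) * x.1 + (c.2 - a.2) * x.2) := by
    intro x
    simp [f, Matrix.toLin_finTwoProd_apply]
  have hdet : LinearMap.det f = cross a b c := by
    simp only [f, LinearMap.det_toLin, Matrix.det_fin_two_of, cross]
    ring
  have himage : ({a, b, c} : Set (ℝ × ℝ)) =
      a +ᵥ f '' {((0 : ℝ), (0 : ℝ)), (1, 0), (0, 1)} := by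
    have hadd : ∀ x : ℝ × ℝ, a + (x.1 - a.1, x.2 - a.2) = x := fun x => add_sub_cancel a x
    have hzero : a + (0, 0) = a := add_zero a
    simp [Set.image_insert_eq, hf, Set.vadd_set_insert, hadd, hzero]
  simp only [area]
  rw [himage, convexHull_vadd, measure_vadd, ← LinearMap.image_convexHull,
    Measure.addHaar_image_linearMap, hdet, ENNReal.toReal_mul,
    ENNReal.toReal_ofReal (abs_nonneg _)]

theorem volume_convexHull_ne_top {s : Set (ℝ × ℝ)} (hs : s.Finite) :
    volume (convexHull ℝ s) ≠ ⊤ :=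
  (hs.isCompact_convexHull (𝕜 := ℝ)).measure_lt_top.ne

theorem area_quadrilateral_ge {a b c d : ℝ × ℝ} (h₁ : 0 < cross a b c) (h₂ : 0 < cross a c d) :
    (cross a b c + cross a c d) * area {(0, 0), (1, 0), (0, 1)} ≤ area {a, b, c, d} := by
  have hac : a ≠ c := by
    rintro rfl
    simp [cross] at h₂
  have hcyc : ∀ x, cross c a x = -cross a c x := fun x => by simp only [cross]; ring
  have hdisj : AEDisjoint volume (convexHull ℝ {a, b, c}) (convexHull ℝ {a, c, d}) := by
    refine measure_mono_null (fun x hx => ?_) (volume_setOf_cross_eq_zero hac)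
    have hx₁ : 0 ≤ cross c a x := by
      refine cross_nonneg_of_mem_convexHull ?_ hx.1
      rintro y (rfl | rfl | rfl) <;> simp only [cross] at * <;> linarith
    have hx₂ : 0 ≤ cross a c x := by
      refine cross_nonneg_of_mem_convexHull ?_ hx.2
      rintro y (rfl | rfl | rfl) <;> simp only [cross] at * <;> linarith
    rw [hcyc] at hx₁
    exact le_antisymm (by linarith) hx₂
  have hsub : convexHull ℝ {a, b, c} ∪ convexHull ℝ {a, c, d} ⊆ convexHull ℝ {a, b, c, d} :=
    Set.union_subset (convexHull_mono (by grind)) (convexHull_mono (by grind))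
  have hmono := ENNReal.toReal_mono (volume_convexHull_ne_top (Set.toFinite {a, b, c, d}))
    (measure_mono (μ := volume) hsub)
  rw [measure_union₀ ((Set.toFinite _).isCompact_convexHull (𝕜 := ℝ)).isClosed.nullMeasurableSet hdisj,
    ENNReal.toReal_add (volume_convexHull_ne_top (Set.toFinite _))
      (volume_convexHull_ne_top (Set.toFinite _))] at hmono
  have e₁ := area_triangle a b c
  have e₂ := area_triangle a c d
  rw [abs_of_pos h₁] at e₁
  rw [abs_of_pos h₂] at e₂
  rw [add_mul, ← e₁, ← e₂]
  exact hmono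

theorem area_pentagon_le {q : Fin 5 → ℝ × ℝ}
    (hq : ∀ i j k, i < j → j < k → 0 < cross (q i) (q j) (q k)) :
    area (Set.range q) ≤ (cross (q 0) (q 1) (q 2) + cross (q 0) (q 2) (q 3) +
      cross (q 0) (q 3) (q 4)) * area {(0, 0), (1, 0), (0, 1)} := by
  have hcyc : ∀ a b x, cross b a x = -cross a b x := fun a b x => by simp only [cross]; ring
  have hside : ∀ i, i < 4 → ∀ x ∈ convexHull ℝ (Set.range q),
      0 ≤ cross (q i) (q (i + 1)) x := by
    intro i hi x hx
    refine cross_nonneg_of_mem_convexHull ?_ hx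
    rintro _ ⟨j, rfl⟩
    rcases lt_trichotomy j i with hj | rfl | hj
    · have := hq j i (i + 1) hj (by grind)
      simp only [cross] at *; linarith
    · simp only [cross]; linarith
    · rcases eq_or_ne j (i + 1) with rfl | hj'
      · simp only [cross]; linarith
      · exact (hq i (i + 1) j (by grind) (by grind)).le
  have hlast : ∀ x ∈ convexHull ℝ (Set.range q), 0 ≤ cross (q 4) (q 0) x := by
    intro x hx
    refine cross_nonneg_of_mem_convexHull ?_ hx
    rintro _ ⟨j, rfl⟩
    rcases eq_or_ne j 0 with rfl | h0
    · simp only [cross]; linarith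
    rcases eq_or_ne j 4 with rfl | h4
    · simp only [cross]; linarith
    have := hq 0 j 4 (by grind) (by grind)
    simp only [cross] at *; linarith
  have hsub : convexHull ℝ (Set.range q) ⊆ convexHull ℝ {q 0, q 1, q 2} ∪
      convexHull ℝ {q 0, q 2, q 3} ∪ convexHull ℝ {q 0, q 3, q 4} := by
    intro x hx
    have s0 := hside 0 (by decide) x hx
    have s1 := hside 1 (by decide) x hx
    have s2 := hside 2 (by decide) x hx
    have s3 := hside 3 (by decide) x hx
    have s4 := hlast x hx
    rcases le_total (cross (q 0) (q 2) x) 0 with h2 | h2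
    · exact .inl (.inl (mem_convexHull_of_cross_nonneg (hq 0 1 2 (by decide) (by decide)) s0 s1
        (by rw [hcyc]; linarith)))
    rcases le_total (cross (q 0) (q 3) x) 0 with h3 | h3
    · exact .inl (.inr (mem_convexHull_of_cross_nonneg (hq 0 2 3 (by decide) (by decide)) h2 s2
        (by rw [hcyc]; linarith)))
    · exact .inr (mem_convexHull_of_cross_nonneg (hq 0 3 4 (by decide) (by decide)) h3 s3 s4)
  have e₁ := area_triangle (q 0) (q 1) (q 2)
  have e₂ := area_triangle (q 0) (q 2) (q 3)
  have e₃ := area_triangle (q 0) (q 3) (q 4)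
  rw [abs_of_pos (hq _ _ _ (by decide) (by decide))] at e₁ e₂ e₃
  rw [add_mul, add_mul, ← e₁, ← e₂, ← e₃]
  have ht : ∀ a b c : ℝ × ℝ, volume (convexHull ℝ {a, b, c}) ≠ ⊤ :=
    fun a b c => volume_convexHull_ne_top (Set.toFinite _)
  refine (measureReal_mono hsub (by simp [ht])).trans ?_
  exact (measureReal_union_le _ _).trans (add_le_add_left (measureReal_union_le _ _) _)

/-- Gauss' pentagon relation between the total area `D` and the ear areas `a, b, c, d, e` bounds
the smallest ear. -/
theorem exists_ear_le {D a b c d e : ℝ} (hD : 0 < D)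
    (hG : D ^ 2 - (a + b + c + d + e) * D + (a * b + b * c + c * d + d * e + e * a) = 0)
    (hac : a + c < D) (hbd : b + d < D) (hce : c + e < D) (hda : d + a < D) (heb : e + b < D) :
    a ≤ (5 - √5) / 10 * D ∨ b ≤ (5 - √5) / 10 * D ∨ c ≤ (5 - √5) / 10 * D ∨
      d ≤ (5 - √5) / 10 * D ∨ e ≤ (5 - √5) / 10 * D := by
  have h5 : √5 ^ 2 = 5 := Real.sq_sqrt (by norm_num)
  have h5' : 0 < √5 := by positivity
  set r := (5 - √5) / 10 with hr
  have hr2 : 5 * r ^ 2 - 5 * r + 1 = 0 := by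
    rw [hr]; linear_combination h5 / 20
  have hrD : 0 < (1 - 2 * r) * D := mul_pos (by rw [hr]; linarith) hD
  by_contra! h
  obtain ⟨ha, hb, hc, hd, he⟩ := h
  have key : ∀ {t u v : ℝ}, r * D < t → u + v < D →
      (t - r * D) * ((u + v - D) - (1 - 2 * r) * D) < 0 := fun ht huv =>
    mul_neg_of_pos_of_neg (by linarith) (by linarith)
  have k₁ := key ha heb
  have k₂ := key hb hac
  have k₃ := key hc hbd
  have k₄ := key hd hce
  have k₅ := key he hda
  have : 2 * (D ^ 2 - (a + b + c + d + e) * D + (a * b + b * c + c * d + d * e + e * a)) =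
      2 * (5 * r ^ 2 - 5 * r + 1) * D ^ 2 +
      (a - r * D) * ((e + b - D) - (1 - 2 * r) * D) +
      (b - r * D) * ((a + c - D) - (1 - 2 * r) * D) +
      (c - r * D) * ((b + d - D) - (1 - 2 * r) * D) +
      (d - r * D) * ((c + e - D) - (1 - 2 * r) * D) +
      (e - r * D) * ((d + a - D) - (1 - 2 * r) * D) := by ring
  rw [hG, hr2] at this
  linarith

theorem exists_quadrilateral_of_cross_pos {q : Fin 5 → ℝ × ℝ}
    (hq : ∀ i j k, i < j → j < k → 0 < cross (q i) (q j) (q k)) :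
    ∃ s : Finset (Fin 5), s.card = 4 ∧
      (5 + √5) / 10 * area (Set.range q) ≤ area (q '' ↑s) := by
  have h012 := hq 0 1 2 (by decide) (by decide)
  have h013 := hq 0 1 3 (by decide) (by decide)
  have h014 := hq 0 1 4 (by decide) (by decide)
  have h023 := hq 0 2 3 (by decide) (by decide)
  have h024 := hq 0 2 4 (by decide) (by decide)
  have h034 := hq 0 3 4 (by decide) (by decide)
  have h123 := hq 1 2 3 (by decide) (by decide)
  have h124 := hq 1 2 4 (by decide) (by decide)
  have h134 := hq 1 3 4 (by decide) (by decide)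
  have h234 := hq 2 3 4 (by decide) (by decide)
  have harea := area_pentagon_le hq
  set D := cross (q 0) (q 1) (q 2) + cross (q 0) (q 2) (q 3) + cross (q 0) (q 3) (q 4) with hD
  set v := area {(0, 0), (1, 0), (0, 1)}
  have hv : 0 ≤ v := ENNReal.toReal_nonneg
  have hr : 0 ≤ (5 + √5) / 10 := by positivity
  have reduce : ∀ (i j k l : Fin 5) (m : ℝ), ({i, j, k, l} : Finset (Fin 5)).card = 4 →
      0 < cross (q i) (q j) (q k) → 0 < cross (q i) (q k) (q l) →
      cross (q i) (q j) (q k) + cross (q i) (q k) (q l) = D - m → m ≤ (5 - √5) / 10 * D →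
      ∃ s : Finset (Fin 5), s.card = 4 ∧
        (5 + √5) / 10 * area (Set.range q) ≤ area (q '' ↑s) := by
    intro i j k l m hcard h₁ h₂ hm hle
    refine ⟨{i, j, k, l}, hcard, ?_⟩
    have hquad := area_quadrilateral_ge h₁ h₂
    rw [hm] at hquad
    have himage : q '' ↑({i, j, k, l} : Finset (Fin 5)) = {q i, q j, q k, q l} := by
      simp [Set.image_insert_eq]
    rw [himage]
    calc (5 + √5) / 10 * area (Set.range q) ≤ (5 + √5) / 10 * (D * v) := by gcongr
      _ = (D - (5 - √5) / 10 * D) * v := by ring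
      _ ≤ (D - m) * v := by gcongr
      _ ≤ _ := hquad
  have hears := exists_ear_le (D := D) (a := cross (q 0) (q 1) (q 4)) (b := cross (q 0) (q 1) (q 2))
    (c := cross (q 1) (q 2) (q 3)) (d := cross (q 2) (q 3) (q 4)) (e := cross (q 0) (q 3) (q 4))
    (by positivity) (by simp only [hD, cross]; ring)
    (by simp only [hD, cross] at *; linarith) (by simp only [hD, cross] at *; linarith)
    (by simp only [hD, cross] at *; linarith) (by simp only [hD, cross] at *; linarith)
    (by simp only [hD, cross] at *; linarith)
  rcases hears with h | h | h | h | h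
  · exact reduce 1 2 3 4 _ (by decide) h123 h134 (by simp only [hD, cross]; ring) h
  · exact reduce 0 2 3 4 _ (by decide) h023 h034 (by simp only [hD, cross]; ring) h
  · exact reduce 0 1 3 4 _ (by decide) h013 h034 (by simp only [hD, cross]; ring) h
  · exact reduce 0 1 2 4 _ (by decide) h012 h024 (by simp only [hD, cross]; ring) h
  · exact reduce 0 1 2 3 _ (by decide) h012 h023 (by simp only [hD, cross]; ring) h

/-- Listing the vertices by their direction as seen from `p 0` orders them counterclockwise. -/
theorem exists_counterclockwise {p : Fin 5 → ℝ × ℝ}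
    (hp : ∀ i, p i ∉ convexHull ℝ (p '' {j | j ≠ i})) :
    ∃ τ : Equiv.Perm (Fin 5), ∀ i j k, i < j → j < k →
      0 < cross (p (τ i)) (p (τ j)) (p (τ k)) := by
  obtain ⟨f, u, hfu, hf⟩ := geometric_hahn_banach_point_closed (convex_convexHull ℝ _)
    ((Set.toFinite (p '' {j | j ≠ 0})).isCompact_convexHull (𝕜 := ℝ)).isClosed (hp 0)
  have hpos : ∀ i : Fin 4, 0 < f (p i.succ - p 0) := by
    intro i
    have := hf (p i.succ) (subset_convexHull ℝ _ ⟨i.succ, Fin.succ_ne_zero i, rfl⟩)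
    rw [map_sub]
    linarith
  set α := f (1, 0)
  set β := f (0, 1)
  have hlin : ∀ x : ℝ × ℝ, f x = α * x.1 + β * x.2 := by
    intro x
    have hx : x = x.1 • ((1 : ℝ), (0 : ℝ)) + x.2 • ((0 : ℝ), (1 : ℝ)) := by ext <;> simp
    conv_lhs => rw [hx]
    rw [map_add, map_smul, map_smul, smul_eq_mul, smul_eq_mul, mul_comm, mul_comm x.2]
  let g : ℝ × ℝ → ℝ := fun x => α * x.2 - β * x.1
  let key : Fin 4 → ℝ := fun i => g (p i.succ - p 0) / f (p i.succ - p 0)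
  have hαβ : 0 < α ^ 2 + β ^ 2 := by
    by_contra! h
    have h1 : α = 0 := by nlinarith [sq_nonneg α, sq_nonneg β]
    have h2 : β = 0 := by nlinarith [sq_nonneg α, sq_nonneg β]
    simpa [hlin, h1, h2] using hpos 0
  have hcross : ∀ i j : Fin 4, (α ^ 2 + β ^ 2) * cross (p 0) (p i.succ) (p j.succ) =
      (key j - key i) * (f (p i.succ - p 0) * f (p j.succ - p 0)) := by
    intro i j
    have hi := (hpos i).ne'
    have hj := (hpos j).ne'
    simp only [key]
    field_simp
    simp only [hlin, g, cross, Prod.fst_sub, Prod.snd_sub]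
    ring
  have hne : ∀ i j : Fin 4, f (p i.succ - p 0) ≤ f (p j.succ - p 0) → key i = key j → i = j := by
    intro i j hle hij
    by_contra hne
    have hj := hpos j
    have hc : cross (p 0) (p i.succ) (p j.succ) = 0 := by
      have := hcross i j
      rw [hij, sub_self, zero_mul] at this
      exact (mul_eq_zero.1 this).resolve_left hαβ.ne'
    refine hp i.succ ?_
    set t := f (p i.succ - p 0) / f (p j.succ - p 0) with ht
    have hmem := (convex_convexHull ℝ (p '' {k | k ≠ i.succ}))
      (subset_convexHull ℝ _ ⟨0, (Fin.succ_ne_zero i).symm, rfl⟩)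
      (subset_convexHull ℝ _ ⟨j.succ, by simpa using Ne.symm hne, rfl⟩)
      (sub_nonneg.2 ((div_le_one hj).2 hle)) (div_nonneg (hpos i).le hj.le)
      (sub_add_cancel 1 t)
    convert hmem using 1
    rw [← ht]
    rw [hlin, hlin] at ht
    rw [hlin] at hj
    simp only [Prod.fst_sub, Prod.snd_sub, cross] at ht hj hc
    ext <;> simp only [Prod.fst_add, Prod.snd_add, Prod.smul_fst, Prod.smul_snd, smul_eq_mul] <;>
      rw [ht] <;> field_simp
    · linear_combination β * hc
    · linear_combination -α * hc
  have hinj : Function.Injective key := fun i j hij =>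
    (le_total (f (p i.succ - p 0)) (f (p j.succ - p 0))).elim (fun h => hne i j h hij)
      fun h => (hne j i h hij.symm).symm
  let σ := Tuple.sort key
  have hσ : StrictMono (key ∘ σ) :=
    (Tuple.monotone_sort key).strictMono_of_injective (hinj.comp σ.injective)
  have hzero : ∀ i j : Fin 4, i < j → 0 < cross (p 0) (p (σ i).succ) (p (σ j).succ) := by
    intro i j hij
    have h : 0 < (α ^ 2 + β ^ 2) * cross (p 0) (p (σ i).succ) (p (σ j).succ) := by
      rw [hcross]
      exact mul_pos (sub_pos.2 (hσ hij)) (mul_pos (hpos _) (hpos _))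
    exact pos_of_mul_pos_right h hαβ.le
  refine ⟨Equiv.Perm.decomposeFin.symm (0, σ), fun i j k hij hjk => ?_⟩
  obtain ⟨j, rfl⟩ := Fin.exists_succ_eq.2 (Fin.ne_zero_of_lt hij)
  obtain ⟨k, rfl⟩ := Fin.exists_succ_eq.2 (Fin.ne_zero_of_lt hjk)
  have hjk' : j < k := Fin.succ_lt_succ_iff.1 hjk
  have hsucc : ∀ i : Fin 4, Equiv.Perm.decomposeFin.symm (0, σ) i.succ = (σ i).succ := by
    intro i; simp
  rcases Fin.eq_zero_or_eq_succ i with rfl | ⟨i, rfl⟩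
  · simpa [hsucc] using hzero j k hjk'
  have hij' : i < j := Fin.succ_lt_succ_iff.1 hij
  rw [hsucc, hsucc, hsucc]
  by_contra! hle
  refine hp (σ j).succ (convexHull_mono ?_ (mem_convexHull_of_cross_nonneg
    (hzero i k (hij'.trans hjk')) (hzero i j hij').le ?_ ?_))
  · rintro _ (rfl | rfl | rfl)
    · exact ⟨0, (Fin.succ_ne_zero _).symm, rfl⟩
    · exact ⟨(σ i).succ, by simpa using hij'.ne, rfl⟩
    · exact ⟨(σ k).succ, by simpa using hjk'.ne', rfl⟩
  · simp only [cross] at *; linarith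
  · have := hzero j k hjk'
    simp only [cross] at *; linarith

/-- Every convex pentagon contains a quadrilateral on four of its vertices whose
area is at least `(5 + √5)/10` times the area of the pentagon. -/
theorem pentagon_contains_large_quadrilateral
    (p : Fin 5 → ℝ × ℝ) (hp : StrictConvexPos p) :
    ∃ s : Finset (Fin 5), s.card = 4 ∧
      (5 + Real.sqrt 5) / 10 * area (Set.range p) ≤ area (p '' ↑s) := by
  obtain ⟨τ, hτ⟩ := exists_counterclockwise hp.1
  obtain ⟨s, hs, hle⟩ := exists_quadrilateral_of_cross_pos (q := p ∘ τ) hτ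
  refine ⟨s.map τ.toEmbedding, by simpa using hs, ?_⟩
  rw [τ.surjective.range_comp, Set.image_comp] at hle
  simpa using hle
end

section
/- In a regular pentagon, every quadrilateral whose vertices are four of the pentagon's five vertices has area exactly (5+√5)/10 times the area of the pentagon. (Hence the constant (5+√5)/10 in the pentagon-to-quadrilateral area bound is optimal, i.e., f_5(4)=(5+√5)/10.) -/
open MeasureTheory

open Real

/-- The closed region between two continuous graphs has measure the integral of the difference. -/
lemma volume_closed_region_between {a b : ℝ} (hab : a ≤ b) {l u : ℝ → ℝ}
    (hl : Continuous l) (hu : Continuous u) (h : ∀ x ∈ Set.Icc a b, l x ≤ u x) :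
    (volume {q : ℝ × ℝ | q.1 ∈ Set.Icc a b ∧ q.2 ∈ Set.Icc (l q.1) (u q.1)}).toReal =
      ∫ x in a..b, (u x - l x) := by
  have hm : MeasurableSet {q : ℝ × ℝ | q.1 ∈ Set.Icc a b ∧ q.2 ∈ Set.Icc (l q.1) (u q.1)} :=
    measurableSet_region_between_cc hl.measurable hu.measurable measurableSet_Icc
  have hs (x : ℝ) : volume (Prod.mk x ⁻¹' {q : ℝ × ℝ | q.1 ∈ Set.Icc a b ∧
      q.2 ∈ Set.Icc (l q.1) (u q.1)}) =
      (Set.Icc a b).indicator (fun x => ENNReal.ofReal (u x - l x)) x := by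
    by_cases hx : x ∈ Set.Icc a b
    · rw [Set.indicator_of_mem hx, ← Real.volume_Icc]
      congr 1
      ext y
      simp only [Set.mem_preimage, Set.mem_ofPred_eq, hx, true_and]
    · rw [Set.indicator_of_notMem hx]
      simp only [Set.preimage_ofPred_eq, hx, false_and, Set.ofPred_false, measure_empty]
  have hnn : 0 ≤ᵐ[volume.restrict (Set.Icc a b)] fun x => u x - l x :=
    ae_restrict_of_forall_mem measurableSet_Icc fun x hx => sub_nonneg.2 (h x hx)
  rw [Measure.volume_eq_prod, Measure.prod_apply hm, lintegral_congr hs,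
    lintegral_indicator measurableSet_Icc, intervalIntegral.integral_of_le hab,
    ← integral_Icc_eq_integral_Ioc,
    integral_eq_lintegral_of_nonneg_ae hnn (hu.sub hl).aestronglyMeasurable]

/-- The trapezoid spanned by four vertices of a regular pentagon, in affine coordinates, is the
region between two graphs. -/
lemma convexHull_golden_trapezoid :
    convexHull ℝ {((0 : ℝ), (0 : ℝ)), (0, 1), (1, 1), (goldenRatio, 0)} =
      {q : ℝ × ℝ | q.1 ∈ Set.Icc 0 goldenRatio ∧
        q.2 ∈ Set.Icc 0 (min 1 (1 - goldenRatio * (q.1 - 1)))} := by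
  have h1 := one_lt_goldenRatio
  have h2 := goldenRatio_sq
  apply subset_antisymm
  · refine convexHull_min ?_ ?_
    · rintro q (rfl | rfl | rfl | rfl) <;>
        simp only [Set.mem_ofPred_eq, Set.mem_Icc, le_min_iff] <;>
        refine ⟨⟨?_, ?_⟩, ?_, ?_, ?_⟩ <;> nlinarith
    · rintro ⟨x, y⟩ hq ⟨x', y'⟩ hq' s t hs ht hst
      simp only [Set.mem_ofPred_eq, Set.mem_Icc, le_min_iff, Prod.smul_mk, Prod.mk_add_mk,
        smul_eq_mul] at hq hq' ⊢
      obtain ⟨⟨ha, hb⟩, hc, hd, he⟩ := hq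
      obtain ⟨⟨ha', hb'⟩, hc', hd', he'⟩ := hq'
      obtain rfl : s = 1 - t := by linarith
      refine ⟨⟨?_, ?_⟩, ?_, ?_, ?_⟩ <;> nlinarith
  · rintro ⟨x, y⟩ hq
    simp only [Set.mem_ofPred_eq, Set.mem_Icc, le_min_iff] at hq
    obtain ⟨⟨ha, hb⟩, hc, hd, he⟩ := hq
    have hpos : 0 < goldenRatio - (goldenRatio - 1) * y := by nlinarith
    have hx : x ≤ goldenRatio - (goldenRatio - 1) * y := by nlinarith
    obtain ⟨t, ht0, ht1, rfl⟩ : ∃ t : ℝ, 0 ≤ t ∧ t ≤ 1 ∧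
        t * (goldenRatio - (goldenRatio - 1) * y) = x :=
      ⟨x / (goldenRatio - (goldenRatio - 1) * y), by positivity, (div_le_one hpos).2 hx,
        div_mul_cancel₀ _ hpos.ne'⟩
    have hC := convex_convexHull ℝ {((0 : ℝ), (0 : ℝ)), (0, 1), (1, 1), (goldenRatio, 0)}
    have hbot := hC (subset_convexHull ℝ _ (by simp : ((0 : ℝ), (0 : ℝ)) ∈ _))
      (subset_convexHull ℝ _ (by simp : (goldenRatio, (0 : ℝ)) ∈ _))
      (sub_nonneg.2 ht1) ht0 (by ring)
    have htop := hC (subset_convexHull ℝ _ (by simp : ((0 : ℝ), (1 : ℝ)) ∈ _))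
      (subset_convexHull ℝ _ (by simp : ((1 : ℝ), (1 : ℝ)) ∈ _))
      (sub_nonneg.2 ht1) ht0 (by ring)
    convert hC hbot htop (sub_nonneg.2 hd) hc (by ring) using 1
    ext
    · simp
      ring
    · simp

/-- An affine image of a regular pentagon is the region between two graphs. -/
lemma convexHull_golden_pentagon :
    convexHull ℝ {((1 : ℝ), 1 - goldenRatio), (0, 0), (0, 1), (1, 1), (goldenRatio, 0)} =
      {q : ℝ × ℝ | q.1 ∈ Set.Icc 0 goldenRatio ∧
        q.2 ∈ Set.Icc (max ((1 - goldenRatio) * q.1) (q.1 - goldenRatio))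
          (min 1 (1 - goldenRatio * (q.1 - 1)))} := by
  have h1 := one_lt_goldenRatio
  have h2 := goldenRatio_sq
  apply subset_antisymm
  · refine convexHull_min ?_ ?_
    · rintro q (rfl | rfl | rfl | rfl | rfl) <;>
        simp only [Set.mem_ofPred_eq, Set.mem_Icc, le_min_iff, max_le_iff] <;>
        refine ⟨⟨?_, ?_⟩, ⟨?_, ?_⟩, ?_, ?_⟩ <;> nlinarith
    · rintro ⟨x, y⟩ hq ⟨x', y'⟩ hq' s t hs ht hst
      simp only [Set.mem_ofPred_eq, Set.mem_Icc, le_min_iff, max_le_iff, Prod.smul_mk,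
        Prod.mk_add_mk, smul_eq_mul] at hq hq' ⊢
      obtain ⟨⟨ha, hb⟩, ⟨hc, hf⟩, hd, he⟩ := hq
      obtain ⟨⟨ha', hb'⟩, ⟨hc', hf'⟩, hd', he'⟩ := hq'
      obtain rfl : s = 1 - t := by linarith
      refine ⟨⟨?_, ?_⟩, ⟨?_, ?_⟩, ?_, ?_⟩ <;> nlinarith
  · rintro ⟨x, y⟩ hq
    rcases le_total 0 y with hy | hy
    · refine convexHull_mono (Set.subset_insert _ _) ?_
      rw [convexHull_golden_trapezoid]
      exact ⟨hq.1, hy, hq.2.2⟩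
    · simp only [Set.mem_ofPred_eq, Set.mem_Icc, le_min_iff, max_le_iff] at hq
      obtain ⟨⟨ha, hb⟩, ⟨hc, hf⟩, hd, he⟩ := hq
      have hC := convex_convexHull ℝ
        {((1 : ℝ), 1 - goldenRatio), (0, 0), (0, 1), (1, 1), (goldenRatio, 0)}
      have hx : 0 ≤ (goldenRatio - 1) * (x + goldenRatio * y) := by nlinarith
      have hsum : 0 ≤ 1 - (-goldenRatio * y) - (goldenRatio - 1) * (x + goldenRatio * y) := by
        nlinarith
      have hw : 0 ≤ -goldenRatio * y := by nlinarith
      have := hC.sum_mem (t := Finset.univ)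
        (w := ![1 - (-goldenRatio * y) - (goldenRatio - 1) * (x + goldenRatio * y),
          -goldenRatio * y, (goldenRatio - 1) * (x + goldenRatio * y)])
        (z := ![((0 : ℝ), (0 : ℝ)), (1, 1 - goldenRatio), (goldenRatio, 0)])
        (by intro i _; fin_cases i <;> assumption)
        (by simp [Fin.sum_univ_three]; ring)
        (by intro i _; apply subset_convexHull; fin_cases i <;> simp)
      convert this using 1
      ext
      · simp [Fin.sum_univ_three]
        linear_combination (-x - goldenRatio * y) * h2
      · simp [Fin.sum_univ_three]
        linear_combination (-y) * h2

/-- The integral of a function that is affine on `[0, 1]` and on `[1, b]`. -/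
lemma integral_two_affine_pieces {f : ℝ → ℝ} (hf : Continuous f) {b α β γ δ : ℝ} (hb : 1 ≤ b)
    (h₀ : ∀ x ∈ Set.Icc 0 1, f x = α + β * x) (h₁ : ∀ x ∈ Set.Icc 1 b, f x = γ + δ * x) :
    ∫ x in (0 : ℝ)..b, f x = α + β / 2 + γ * (b - 1) + δ * (b ^ 2 - 1) / 2 := by
  have haff (a b α β : ℝ) :
      ∫ x in a..b, (α + β * x) = α * (b - a) + β * (b ^ 2 - a ^ 2) / 2 := by
    rw [intervalIntegral.integral_add intervalIntegrable_const
      (Continuous.intervalIntegrable (by fun_prop) _ _), intervalIntegral.integral_const,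
      intervalIntegral.integral_const_mul, integral_id, smul_eq_mul]
    ring
  rw [← intervalIntegral.integral_add_adjacent_intervals (b := 1)
      (hf.intervalIntegrable _ _) (hf.intervalIntegrable _ _),
    intervalIntegral.integral_congr (a := 0) (g := fun x => α + β * x)
      (by rwa [Set.uIcc_of_le zero_le_one]),
    intervalIntegral.integral_congr (a := 1) (g := fun x => γ + δ * x)
      (by rwa [Set.uIcc_of_le hb]), haff, haff]
  ring

lemma area_golden_trapezoid :
    area {((0 : ℝ), (0 : ℝ)), (0, 1), (1, 1), (goldenRatio, 0)} = (1 + goldenRatio) / 2 := by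
  have h1 := one_lt_goldenRatio
  have h2 := goldenRatio_sq
  rw [area, convexHull_golden_trapezoid, volume_closed_region_between (l := fun _ => 0)
    (u := fun x => min 1 (1 - goldenRatio * (x - 1))) (by linarith) (by fun_prop) (by fun_prop),
    integral_two_affine_pieces (α := 1) (β := 0) (γ := 1 + goldenRatio) (δ := -goldenRatio)
      (by fun_prop) h1.le]
  · linear_combination (1 / 2 - goldenRatio / 2) * h2
  · intro x hx
    rw [min_eq_left (by nlinarith [hx.2])]
    ring
  · intro x hx
    rw [min_eq_right (by nlinarith [hx.1])]
    ring
  · intro x hx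
    exact le_min zero_le_one (by nlinarith [hx.2])

lemma area_golden_pentagon :
    area {((1 : ℝ), 1 - goldenRatio), (0, 0), (0, 1), (1, 1), (goldenRatio, 0)} =
      (2 + goldenRatio) / 2 := by
  have h1 := one_lt_goldenRatio
  have h2 := goldenRatio_sq
  rw [area, convexHull_golden_pentagon, volume_closed_region_between
    (l := fun x => max ((1 - goldenRatio) * x) (x - goldenRatio))
    (u := fun x => min 1 (1 - goldenRatio * (x - 1))) (by linarith) (by fun_prop) (by fun_prop),
    integral_two_affine_pieces (α := 1) (β := goldenRatio - 1) (γ := 1 + 2 * goldenRatio)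
      (δ := -goldenRatio - 1) (by fun_prop) h1.le]
  · linear_combination (1 - goldenRatio / 2) * h2
  · intro x hx
    rw [min_eq_left (by nlinarith [hx.2]), max_eq_left (by nlinarith [hx.2])]
    ring
  · intro x hx
    rw [min_eq_right (by nlinarith [hx.1]), max_eq_right (by nlinarith [hx.1])]
    ring
  · intro x hx
    refine max_le (le_min ?_ ?_) (le_min ?_ ?_) <;> nlinarith [hx.1, hx.2]

open scoped Pointwise in
/-- Affine maps preserve ratios of areas. -/
lemma area_image_affine (L : ℝ × ℝ →ₗ[ℝ] ℝ × ℝ) (a : ℝ × ℝ) (S : Set (ℝ × ℝ)) :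
    area ((fun q => a + L q) '' S) = |LinearMap.det L| * area S := by
  have : (fun q => a + L q) '' S = a +ᵥ L '' S := by
    rw [← Set.image_vadd, Set.image_image]; rfl
  rw [area, area, this, convexHull_vadd, ← LinearMap.image_convexHull, measure_vadd,
    Measure.addHaar_image_linearMap, ENNReal.toReal_mul, ENNReal.toReal_ofReal (abs_nonneg _)]

/-- Parallelism of sides and diagonals, with golden length ratio, determines the area ratio. -/
lemma area_ratio_of_golden_relations {a₀ a₁ a₂ a₃ a₄ : ℝ × ℝ}
    (h : a₄ - a₁ = goldenRatio • (a₃ - a₂)) (h' : a₄ - a₂ = goldenRatio • (a₀ - a₁)) :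
    area {a₁, a₂, a₃, a₄} = (5 + √5) / 10 * area {a₀, a₁, a₂, a₃, a₄} := by
  have h2 := goldenRatio_sq
  let L : ℝ × ℝ →ₗ[ℝ] ℝ × ℝ :=
    (LinearMap.fst ℝ ℝ ℝ).smulRight (a₃ - a₂) + (LinearMap.snd ℝ ℝ ℝ).smulRight (a₂ - a₁)
  have hL (x y : ℝ) : L (x, y) = x • (a₃ - a₂) + y • (a₂ - a₁) := rfl
  have e4 : a₁ + L (goldenRatio, 0) = a₄ := by
    rw [hL, ← h]; module
  have e0 : a₁ + L (1, 1 - goldenRatio) = a₀ := by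
    rw [hL]
    have hx := congrArg Prod.fst h
    have hy := congrArg Prod.snd h
    have hx' := congrArg Prod.fst h'
    have hy' := congrArg Prod.snd h'
    simp only [Prod.fst_sub, Prod.snd_sub, Prod.smul_fst, Prod.smul_snd, smul_eq_mul]
      at hx hy hx' hy'
    ext
    · simp
      linear_combination (goldenRatio - 1) * (hx' - hx) + (a₀.1 - a₁.1 - a₃.1 + a₂.1) * h2
    · simp
      linear_combination (goldenRatio - 1) * (hy' - hy) + (a₀.2 - a₁.2 - a₃.2 + a₂.2) * h2
  have hq := area_image_affine L a₁ {((0 : ℝ), (0 : ℝ)), (0, 1), (1, 1), (goldenRatio, 0)}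
  have hp := area_image_affine L a₁
    {((1 : ℝ), 1 - goldenRatio), (0, 0), (0, 1), (1, 1), (goldenRatio, 0)}
  have e1 : a₁ + L (0, 0) = a₁ := by rw [hL]; module
  have e2 : a₁ + L (0, 1) = a₂ := by rw [hL]; module
  have e3 : a₁ + L (1, 1) = a₃ := by rw [hL]; module
  simp only [Set.image_insert_eq, Set.image_singleton, e0, e1, e2, e3, e4] at hq hp
  rw [hq, hp, area_golden_trapezoid, area_golden_pentagon]
  have h5 : √5 = 2 * goldenRatio - 1 := by unfold goldenRatio; ring
  rw [h5]
  linear_combination (-|LinearMap.det L| / 10) * h2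

/-- In a regular pentagon each diagonal is `φ` times the side parallel to it. -/
lemma regular_pentagon_diagonal (c : ℝ × ℝ) (R θ : ℝ) (p : Fin 5 → ℝ × ℝ)
    (hp : ∀ k : Fin 5, p k =
      (c.1 + R * Real.cos (2 * Real.pi * (k.val : ℝ) / 5 + θ),
       c.2 + R * Real.sin (2 * Real.pi * (k.val : ℝ) / 5 + θ))) (k : Fin 5) :
    p (k + 3) - p k = goldenRatio • (p (k + 2) - p (k + 1)) := by
  have h2 := goldenRatio_sq
  have hcos : cos (π / 5) = goldenRatio / 2 := by
    rw [cos_pi_div_five]; unfold goldenRatio; ring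
  set S := sin (2 * π / 5) with hS
  have c1 : cos (2 * π / 5) = (goldenRatio - 1) / 2 := by
    rw [show 2 * π / 5 = 2 * (π / 5) by ring, cos_two_mul, hcos]
    linear_combination h2 / 2
  have c2 : cos (2 * π * 2 / 5) = -goldenRatio / 2 := by
    rw [show 2 * π * 2 / 5 = 2 * (2 * π / 5) by ring, cos_two_mul, c1]
    linear_combination h2 / 2
  have s2 : sin (2 * π * 2 / 5) = (goldenRatio - 1) * S := by
    rw [show 2 * π * 2 / 5 = 2 * (2 * π / 5) by ring, sin_two_mul, c1]
    ring
  have e3 : 2 * π * 3 / 5 = 2 * π - 2 * π * 2 / 5 := by ring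
  have e4 : 2 * π * 4 / 5 = 2 * π - 2 * π / 5 := by ring
  have p0 : p 0 = (c.1 + R * cos θ, c.2 + R * sin θ) := by simp [hp]
  have p1 : p 1 = (c.1 + R * ((goldenRatio - 1) / 2 * cos θ - S * sin θ),
      c.2 + R * (S * cos θ + (goldenRatio - 1) / 2 * sin θ)) := by
    simp [hp, cos_add, sin_add, c1, ← hS]
  have p2 : p 2 = (c.1 + R * (-goldenRatio / 2 * cos θ - (goldenRatio - 1) * S * sin θ),
      c.2 + R * ((goldenRatio - 1) * S * cos θ + -goldenRatio / 2 * sin θ)) := by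
    simp [hp, cos_add, sin_add, c2, s2]
  have p3 : p 3 = (c.1 + R * (-goldenRatio / 2 * cos θ + (goldenRatio - 1) * S * sin θ),
      c.2 + R * (-((goldenRatio - 1) * S) * cos θ + -goldenRatio / 2 * sin θ)) := by
    simp [hp, cos_add, sin_add, e3, cos_two_pi_sub, sin_two_pi_sub, c2, s2]
  have p4 : p 4 = (c.1 + R * ((goldenRatio - 1) / 2 * cos θ + S * sin θ),
      c.2 + R * (-S * cos θ + (goldenRatio - 1) / 2 * sin θ)) := by
    simp [hp, cos_add, sin_add, e4, cos_two_pi_sub, sin_two_pi_sub, c1, ← hS]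
  fin_cases k <;> ext <;> simp [p0, p1, p2, p3, p4] <;> grind

/-- In a regular pentagon, every quadrilateral on four of the five vertices has
area exactly `(5 + √5)/10` times the area of the pentagon. -/
theorem regular_pentagon_quadrilateral_ratio
    (c : ℝ × ℝ) (R θ : ℝ) (hR : 0 < R) (p : Fin 5 → ℝ × ℝ)
    (hp : ∀ k : Fin 5, p k =
      (c.1 + R * Real.cos (2 * Real.pi * (k.val : ℝ) / 5 + θ),
       c.2 + R * Real.sin (2 * Real.pi * (k.val : ℝ) / 5 + θ))) :
    ∀ s : Finset (Fin 5), s.card = 4 →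
      area (p '' ↑s) = (5 + Real.sqrt 5) / 10 * area (Set.range p) := by
  intro s hs
  obtain ⟨m, rfl⟩ : ∃ m : Fin 5, s = {m + 1, m + 2, m + 3, m + 4} := by
    revert s
    decide
  have huniv : (Set.univ : Set (Fin 5)) = {m, m + 1, m + 2, m + 3, m + 4} := by
    ext k
    simp only [Set.mem_univ, Set.mem_insert_iff, Set.mem_singleton_iff, true_iff]
    revert m k
    decide
  rw [← Set.image_univ, huniv]
  simp only [Finset.coe_insert, Finset.coe_singleton, Set.image_insert_eq, Set.image_singleton]
  have hd := regular_pentagon_diagonal c R θ p hp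
  apply area_ratio_of_golden_relations
  · simpa [add_assoc] using hd (m + 1)
  · have := hd (m + 4)
    simp only [add_assoc, show (4 + 3 : Fin 5) = 2 from rfl, show (4 + 2 : Fin 5) = 1 from rfl,
      show (4 + 1 : Fin 5) = 0 from rfl, add_zero] at this
    rw [← neg_sub, this, ← smul_neg, neg_sub]
end

section
/- Every convex pentagon contains a triangle whose vertices are three of the pentagon's vertices and whose area is at least 1/√5 times the area of the pentagon. -/
open MeasureTheory

/-- Twice the signed area of the triangle `a b c`. -/
def orient (a b c : ℝ × ℝ) : ℝ :=
  (b.1 - a.1) * (c.2 - a.2) - (b.2 - a.2) * (c.1 - a.1)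

lemma convex_orient_nonneg (a b : ℝ × ℝ) : Convex ℝ {x | 0 ≤ orient a b x} := by
  intro x hx y hy s t hs ht hst
  simp only [Set.mem_ofPred_eq, orient, Prod.fst_add, Prod.snd_add, Prod.smul_fst, Prod.smul_snd,
    smul_eq_mul] at *
  have hs' : s = 1 - t := by linarith
  have := add_nonneg (mul_nonneg hs hx) (mul_nonneg ht hy)
  subst hs'
  linarith

lemma mem_convexHull_triple {a b c x : ℝ × ℝ} (h : 0 < orient a b c) (hab : 0 ≤ orient a b x)
    (hbc : 0 ≤ orient b c x) (hca : 0 ≤ orient c a x) : x ∈ convexHull ℝ {a, b, c} := by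
  have hsum : orient b c x + orient c a x + orient a b x = orient a b c := by
    simp only [orient]; ring
  have key : x = (orient b c x / orient a b c) • a + (orient c a x / orient a b c) • b
      + (orient a b x / orient a b c) • c := by
    ext <;> simp only [Prod.fst_add, Prod.snd_add, Prod.smul_fst, Prod.smul_snd, smul_eq_mul] <;>
      field_simp <;> simp only [orient] <;> ring
  rw [key]
  have hconv := convex_convexHull ℝ ({a, b, c} : Set (ℝ × ℝ))
  refine hconv.sum_mem (t := Finset.univ)
    (w := ![orient b c x / orient a b c, orient c a x / orient a b c, orient a b x / orient a b c])
    (z := ![a, b, c]) ?_ ?_ ?_ |> fun h => by simpa [Fin.sum_univ_three] using h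
  · intro i _
    fin_cases i
    · exact div_nonneg hbc h.le
    · exact div_nonneg hca h.le
    · exact div_nonneg hab h.le
  · simp only [Fin.sum_univ_three, Matrix.cons_val_zero, Matrix.cons_val_one, Matrix.cons_val]
    rw [← add_div, ← add_div, hsum, div_self h.ne']
  · intro i _
    apply subset_convexHull
    fin_cases i <;> simp

open Pointwise in
lemma volume_convexHull_triple (a b c : ℝ × ℝ) :
    volume (convexHull ℝ {a, b, c}) = ENNReal.ofReal |orient a b c| *
      volume (convexHull ℝ {((0 : ℝ), (0 : ℝ)), (1, 0), (0, 1)}) := by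
  set L : ℝ × ℝ →ₗ[ℝ] ℝ × ℝ := Matrix.toLin (Module.Basis.finTwoProd ℝ) (Module.Basis.finTwoProd ℝ)
    !![b.1 - a.1, c.1 - a.1; b.2 - a.2, c.2 - a.2] with hL
  have hdet : LinearMap.det L = orient a b c := by
    rw [hL, LinearMap.det_toLin, Matrix.det_fin_two_of, orient]; ring
  have himg : ({a, b, c} : Set (ℝ × ℝ)) =
      a +ᵥ (L '' {((0 : ℝ), (0 : ℝ)), (1, 0), (0, 1)}) := by
    simp only [Set.image_insert_eq, Set.image_singleton, hL, Matrix.toLin_finTwoProd_apply,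
      ← Set.image_vadd, vadd_eq_add]
    congr! 1
    · ext <;> simp
    congr! 1
    · ext <;> simp
    · congr! 1
      ext <;> simp
  rw [himg, convexHull_vadd, measure_vadd, ← LinearMap.image_convexHull,
    Measure.addHaar_image_linearMap, hdet]

lemma area_triple (a b c : ℝ × ℝ) :
    area {a, b, c} = |orient a b c| * area {((0 : ℝ), (0 : ℝ)), (1, 0), (0, 1)} := by
  rw [area, volume_convexHull_triple, ENNReal.toReal_mul, ENNReal.toReal_ofReal (abs_nonneg _), area]

lemma area_nonneg (S : Set (ℝ × ℝ)) : 0 ≤ area S := ENNReal.toReal_nonneg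

lemma volume_convexHull_ne_top_s4 {S : Set (ℝ × ℝ)} (hS : S.Finite) :
    volume (convexHull ℝ S) ≠ ⊤ :=
  (hS.isCompact_convexHull ℝ).measure_ne_top

lemma orient_rotate (a b c : ℝ × ℝ) : orient b c a = orient a b c := by
  simp only [orient]; ring

lemma orient_swap (a b c : ℝ × ℝ) : orient b a c = -orient a b c := by
  simp only [orient]; ring

lemma convexHull_subset_fan {q : Fin 5 → ℝ × ℝ}
    (h : ∀ i j k, i < j → j < k → 0 < orient (q i) (q j) (q k)) :
    convexHull ℝ (Set.range q) ⊆ convexHull ℝ {q 0, q 1, q 2} ∪ convexHull ℝ {q 0, q 2, q 3} ∪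
      convexHull ℝ {q 0, q 3, q 4} := by
  intro x hx
  have side : ∀ i j, (∀ k, 0 ≤ orient (q i) (q j) (q k)) → 0 ≤ orient (q i) (q j) x := by
    intro i j hij
    have hsub : Set.range q ⊆ {x | 0 ≤ orient (q i) (q j) x} := by
      rintro _ ⟨k, rfl⟩
      exact hij k
    exact convexHull_min hsub (convex_orient_nonneg _ _) hx
  have hi : ∀ i j : Fin 5, i < j → (∀ k, k ≤ i ∨ j ≤ k) → 0 ≤ orient (q i) (q j) x := by
    intro i j hij hk
    apply side
    intro k
    rcases hk k with hk | hk
    · rcases hk.eq_or_lt with rfl | hk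
      · simp [orient]
      · rw [orient_rotate]
        exact (h _ _ _ hk hij).le
    · rcases hk.eq_or_lt with rfl | hk
      · simp [orient, mul_comm]
      · exact (h _ _ _ hij hk).le
  have h01 := hi 0 1 (by decide) (by decide)
  have h12 := hi 1 2 (by decide) (by decide)
  have h23 := hi 2 3 (by decide) (by decide)
  have h34 := hi 3 4 (by decide) (by decide)
  have h40 : 0 ≤ orient (q 4) (q 0) x := by
    apply side
    intro k
    rw [← orient_rotate, ← orient_rotate]
    rcases (Fin.zero_le k).eq_or_lt with rfl | hk
    · simp [orient]
    · rcases (Fin.le_last k).eq_or_lt with rfl | hk'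
      · simp [orient]
      · rw [orient_rotate]
        have := h 0 k 4 hk hk'
        simp only [orient] at this ⊢
        linarith
  rcases le_total (orient (q 0) (q 2) x) 0 with h02 | h02
  · exact Or.inl <| Or.inl <| mem_convexHull_triple (h 0 1 2 (by decide) (by decide)) h01 h12
      (by rw [orient_swap]; linarith)
  rcases le_total (orient (q 0) (q 3) x) 0 with h03 | h03
  · exact Or.inl <| Or.inr <| mem_convexHull_triple (h 0 2 3 (by decide) (by decide)) h02 h23
      (by rw [orient_swap]; linarith)
  · exact Or.inr <| mem_convexHull_triple (h 0 3 4 (by decide) (by decide)) h03 h34 h40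

lemma area_le_fan {q : Fin 5 → ℝ × ℝ}
    (h : ∀ i j k, i < j → j < k → 0 < orient (q i) (q j) (q k)) :
    area (Set.range q) ≤ (orient (q 0) (q 1) (q 2) + orient (q 0) (q 2) (q 3) +
      orient (q 0) (q 3) (q 4)) * area {((0 : ℝ), (0 : ℝ)), (1, 0), (0, 1)} := by
  have hvol : area (Set.range q) ≤ area {q 0, q 1, q 2} + area {q 0, q 2, q 3} +
      area {q 0, q 3, q 4} := by
    have h1 := volume_convexHull_ne_top_s4 (Set.toFinite {q 0, q 1, q 2})
    have h2 := volume_convexHull_ne_top_s4 (Set.toFinite {q 0, q 2, q 3})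
    have h3 := volume_convexHull_ne_top_s4 (Set.toFinite {q 0, q 3, q 4})
    simp only [area]
    rw [← ENNReal.toReal_add h1 h2, ← ENNReal.toReal_add (ENNReal.add_ne_top.2 ⟨h1, h2⟩) h3]
    refine ENNReal.toReal_mono (ENNReal.add_ne_top.2 ⟨ENNReal.add_ne_top.2 ⟨h1, h2⟩, h3⟩) ?_
    exact (measure_mono (convexHull_subset_fan h)).trans
      ((measure_union_le _ _).trans (add_le_add_left (measure_union_le _ _) _))
  rw [area_triple (q 0) (q 1), area_triple (q 0) (q 2), area_triple (q 0) (q 3), abs_of_pos (h 0 1 2 (by decide) (by decide)),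
    abs_of_pos (h 0 2 3 (by decide) (by decide)),
    abs_of_pos (h 0 3 4 (by decide) (by decide))] at hvol
  linarith

/-- A point of a strictly convex configuration sees the remaining points in a strict angular
order. -/
lemma exists_perm_orient_zero_pos {n : ℕ} {p : Fin (n + 1) → ℝ × ℝ}
    (hp : ∀ i, p i ∉ convexHull ℝ (p '' {j | j ≠ i})) :
    ∃ π : Equiv.Perm (Fin (n + 1)), ∀ j k, 0 < j → j < k →
      0 < orient (p (π 0)) (p (π j)) (p (π k)) := by
  obtain ⟨f, u, hf0, hf⟩ := geometric_hahn_banach_point_closed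
    (convex_convexHull ℝ (p '' {j | j ≠ 0}))
    ((Set.toFinite (p '' {j | j ≠ 0})).isClosed_convexHull ℝ) (hp 0)
  have hpos : ∀ j : Fin n, 0 < f (p j.succ - p 0) := by
    intro j
    rw [map_sub, sub_pos]
    exact hf0.trans (hf _ (subset_convexHull _ _ ⟨j.succ, Fin.succ_ne_zero j, rfl⟩))
  have hfe : ∀ v : ℝ × ℝ, f v = v.1 * f (1, 0) + v.2 * f (0, 1) := by
    intro v
    conv_lhs => rw [show v = v.1 • ((1 : ℝ), (0 : ℝ)) + v.2 • ((0 : ℝ), (1 : ℝ)) by ext <;> simp]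
    rw [map_add, map_smul, map_smul, smul_eq_mul, smul_eq_mul]
  set α := f (1, 0)
  set β := f (0, 1)
  let g : ℝ × ℝ → ℝ := fun v => α * v.2 - β * v.1
  have hfg : ∀ v w : ℝ × ℝ, (α ^ 2 + β ^ 2) * (v.1 * w.2 - v.2 * w.1) = f v * g w - g v * f w := by
    intro v w
    rw [hfe v, hfe w]
    simp only [g]
    ring
  let key : Fin n → ℝ := fun j => g (p j.succ - p 0) / f (p j.succ - p 0)
  have hαβ : ∀ _ : Fin n, 0 < α ^ 2 + β ^ 2 := by
    intro j
    by_contra hcon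
    have hα : α = 0 := by nlinarith [sq_nonneg α, sq_nonneg β]
    have hβ : β = 0 := by nlinarith [sq_nonneg α, sq_nonneg β]
    have := hpos j
    rw [hfe, hα, hβ] at this
    simp at this
  have horient : ∀ j k, (α ^ 2 + β ^ 2) * orient (p 0) (p j.succ) (p k.succ) =
      f (p j.succ - p 0) * f (p k.succ - p 0) * (key k - key j) := by
    intro j k
    have h1 := (hpos j).ne'
    have h2 := (hpos k).ne'
    have := hfg (p j.succ - p 0) (p k.succ - p 0)
    simp only [Prod.fst_sub, Prod.snd_sub] at this
    rw [orient, this]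
    simp only [key]
    field_simp
  have hseg : ∀ j k : Fin n, j ≠ k → orient (p 0) (p j.succ) (p k.succ) = 0 →
      f (p k.succ - p 0) ≤ f (p j.succ - p 0) → False := by
    intro j k hjk h0 hle
    apply hp k.succ
    have hj := hpos j
    have hmem : p k.succ ∈ segment ℝ (p 0) (p j.succ) := by
      rw [segment_eq_image']
      refine ⟨f (p k.succ - p 0) / f (p j.succ - p 0),
        ⟨div_nonneg (hpos k).le hj.le, (div_le_one hj).2 hle⟩, ?_⟩
      simp only [orient] at h0
      rw [hfe] at hj
      simp only [hfe]
      ext <;>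
        simp only [Prod.fst_add, Prod.snd_add, Prod.smul_fst, Prod.smul_snd, Prod.fst_sub,
          Prod.snd_sub, smul_eq_mul] at * <;>
        rw [← eq_sub_iff_add_eq', div_mul_eq_mul_div, div_eq_iff hj.ne']
      · linear_combination β * h0
      · linear_combination (-α) * h0
    refine segment_subset_convexHull ?_ ?_ hmem
    · exact ⟨0, (Fin.succ_ne_zero k).symm, rfl⟩
    · exact ⟨j.succ, fun h => hjk (Fin.succ_injective _ h), rfl⟩
  have hinj : Function.Injective key := by
    intro j k hjk
    by_contra hne
    have h0 : ∀ j k, key j = key k → orient (p 0) (p j.succ) (p k.succ) = 0 := by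
      intro j k hjk
      have := horient j k
      rw [hjk, sub_self, mul_zero] at this
      exact (mul_eq_zero.1 this).resolve_left (hαβ j).ne'
    rcases le_total (f (p k.succ - p 0)) (f (p j.succ - p 0)) with h | h
    · exact hseg j k hne (h0 j k hjk) h
    · exact hseg k j (Ne.symm hne) (h0 k j hjk.symm) h
  have hmono : StrictMono (key ∘ Tuple.sort key) :=
    (Tuple.monotone_sort key).strictMono_of_injective (hinj.comp (Tuple.sort key).injective)
  refine ⟨Equiv.Perm.decomposeFin.symm (0, Tuple.sort key), ?_⟩
  intro j k hj hjk
  obtain ⟨j, rfl⟩ := Fin.exists_succ_eq.2 hj.ne'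
  obtain ⟨k, rfl⟩ := Fin.exists_succ_eq.2 (hj.trans hjk).ne'
  have hlt := hmono (Fin.succ_lt_succ_iff.1 hjk)
  simp only [Equiv.Perm.decomposeFin_symm_apply_zero, Equiv.Perm.decomposeFin_symm_apply_succ,
    Equiv.swap_self, Equiv.refl_apply]
  have := horient (Tuple.sort key j) (Tuple.sort key k)
  refine pos_of_mul_pos_right (this ▸ ?_) (hαβ j).le
  exact mul_pos (mul_pos (hpos _) (hpos _)) (sub_pos.2 hlt)

/-- Points in strictly convex position can be listed in counterclockwise order. -/
lemma exists_perm_orient_pos {n : ℕ} {p : Fin (n + 1) → ℝ × ℝ}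
    (hp : ∀ i, p i ∉ convexHull ℝ (p '' {j | j ≠ i})) :
    ∃ π : Equiv.Perm (Fin (n + 1)), ∀ i j k, i < j → j < k →
      0 < orient (p (π i)) (p (π j)) (p (π k)) := by
  obtain ⟨π, hπ⟩ := exists_perm_orient_zero_pos hp
  refine ⟨π, fun i j k hij hjk => ?_⟩
  rcases (Fin.zero_le i).eq_or_lt with rfl | hi
  · exact hπ j k hij hjk
  by_contra hcon
  apply hp (π j)
  have hsub : ({p (π 0), p (π i), p (π k)} : Set (ℝ × ℝ)) ⊆ p '' {m | m ≠ π j} := by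
    rintro x (rfl | rfl | rfl)
    · exact ⟨_, fun h => (hi.trans hij).ne (π.injective h), rfl⟩
    · exact ⟨_, fun h => hij.ne (π.injective h), rfl⟩
    · exact ⟨_, fun h => hjk.ne' (π.injective h), rfl⟩
  refine convexHull_mono hsub (mem_convexHull_triple (hπ i k hi (hij.trans hjk))
    (hπ i j hi hij).le ?_ ?_)
  · simp only [orient] at hcon ⊢
    linarith
  · rw [orient_rotate, orient_rotate] at *
    have := hπ j k (hi.trans hij) hjk
    simp only [orient] at this ⊢
    linarith

/-- Bound on a cyclic system satisfying Gauss's pentagon relation, when the first entry is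
smallest. -/
lemma gauss_relation_bound_of_min {P g₀ g₁ g₂ g₃ g₄ : ℝ} (hP : 0 < P) (h₀ : 0 ≤ g₀)
    (h₁ : g₀ ≤ g₁) (h₂ : g₀ ≤ g₂) (h₃ : g₀ ≤ g₃) (h₄ : g₀ ≤ g₄)
    (c₀ : 0 < P - g₀ - g₁) (c₁ : 0 < P - g₁ - g₂) (c₂ : 0 < P - g₂ - g₃)
    (c₃ : 0 < P - g₃ - g₄) (c₄ : 0 < P - g₄ - g₀)
    (hG : P ^ 2 - P * (g₀ + g₁ + g₂ + g₃ + g₄) +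
      (g₀ * g₂ + g₁ * g₃ + g₂ * g₄ + g₃ * g₀ + g₄ * g₁) = 0) :
    P / √5 ≤ P - g₀ - g₁ ∨ P / √5 ≤ P - g₁ - g₂ ∨ P / √5 ≤ P - g₂ - g₃ ∨
      P / √5 ≤ P - g₃ - g₄ ∨ P / √5 ≤ P - g₄ - g₀ := by
  by_contra! hcon
  obtain ⟨d₀, d₁, d₂, d₃, d₄⟩ := hcon
  have hr : √5 * √5 = 5 := Real.mul_self_sqrt (by norm_num)
  have hr0 : 0 < √5 := by positivity
  obtain ⟨w, hw⟩ : ∃ w, w = P / √5 := ⟨_, rfl⟩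
  have hw0 : 0 < w := hw ▸ by positivity
  rw [← hw] at d₀ d₁ d₂ d₃ d₄
  have hPw : P ^ 2 = 5 * w ^ 2 := by
    rw [hw]; field_simp; nlinarith
  obtain ⟨c, hc⟩ : ∃ c, P = w + 2 * c := ⟨(P - w) / 2, by ring⟩
  have hcw : c < w := by nlinarith
  obtain ⟨t₀, rfl⟩ : ∃ t, g₀ = c + t := ⟨g₀ - c, by ring⟩
  obtain ⟨t₁, rfl⟩ : ∃ t, g₁ = c + t := ⟨g₁ - c, by ring⟩
  obtain ⟨t₂, rfl⟩ : ∃ t, g₂ = c + t := ⟨g₂ - c, by ring⟩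
  obtain ⟨t₃, rfl⟩ : ∃ t, g₃ = c + t := ⟨g₃ - c, by ring⟩
  obtain ⟨t₄, rfl⟩ : ∃ t, g₄ = c + t := ⟨g₄ - c, by ring⟩
  subst hc
  have hQ : -w * (t₀ + t₁ + t₂ + t₃ + t₄) +
      (t₀ * t₂ + t₁ * t₃ + t₂ * t₄ + t₃ * t₀ + t₄ * t₁) = 0 := by
    linear_combination hG + hPw / 4
  rcases le_or_gt 0 t₀ with ht | ht
  · have e₀ := mul_nonneg ht c₂.le
    have e₁ := mul_nonneg (show 0 ≤ t₁ by linarith) c₃.le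
    have e₂ := mul_nonneg (show 0 ≤ t₂ by linarith) c₄.le
    have e₃ := mul_nonneg (show 0 ≤ t₃ by linarith) c₀.le
    have e₄ := mul_nonneg (show 0 ≤ t₄ by linarith) c₁.le
    have e := mul_pos hw0 (show 0 < t₀ + t₁ + t₂ + t₃ + t₄ by linarith)
    linarith
  · have e₁ := mul_nonneg (show 0 ≤ t₁ + t₀ by linarith) c₃.le
    have e₄ := mul_nonneg (show 0 ≤ t₄ + t₀ by linarith) c₁.le
    have e := mul_pos hw0 (show 0 < t₂ + t₃ by linarith)
    have e' := mul_pos (neg_pos.2 ht) (show 0 < w + t₀ by linarith)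
    have e'' := mul_nonneg (show 0 ≤ t₁ + t₀ by linarith) (show 0 ≤ t₄ + t₀ by linarith)
    linarith

lemma gauss_relation_bound {P g₀ g₁ g₂ g₃ g₄ : ℝ} (hP : 0 < P) (h₀ : 0 ≤ g₀)
    (h₁ : 0 ≤ g₁) (h₂ : 0 ≤ g₂) (h₃ : 0 ≤ g₃) (h₄ : 0 ≤ g₄)
    (c₀ : 0 < P - g₀ - g₁) (c₁ : 0 < P - g₁ - g₂) (c₂ : 0 < P - g₂ - g₃)
    (c₃ : 0 < P - g₃ - g₄) (c₄ : 0 < P - g₄ - g₀)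
    (hG : P ^ 2 - P * (g₀ + g₁ + g₂ + g₃ + g₄) +
      (g₀ * g₂ + g₁ * g₃ + g₂ * g₄ + g₃ * g₀ + g₄ * g₁) = 0) :
    P / √5 ≤ P - g₀ - g₁ ∨ P / √5 ≤ P - g₁ - g₂ ∨ P / √5 ≤ P - g₂ - g₃ ∨
      P / √5 ≤ P - g₃ - g₄ ∨ P / √5 ≤ P - g₄ - g₀ := by
  obtain ⟨i, hi⟩ := Finite.exists_min ![g₀, g₁, g₂, g₃, g₄]
  have m₀ := hi 0
  have m₁ := hi 1
  have m₂ := hi 2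
  have m₃ := hi 3
  have m₄ := hi 4
  fin_cases i <;> simp at m₀ m₁ m₂ m₃ m₄
  · exact gauss_relation_bound_of_min hP h₀ m₁ m₂ m₃ m₄ c₀ c₁ c₂ c₃ c₄ hG
  · have := gauss_relation_bound_of_min hP h₁ m₂ m₃ m₄ m₀ c₁ c₂ c₃ c₄ c₀ (by linarith)
    tauto
  · have := gauss_relation_bound_of_min hP h₂ m₃ m₄ m₀ m₁ c₂ c₃ c₄ c₀ c₁ (by linarith)
    tauto
  · have := gauss_relation_bound_of_min hP h₃ m₄ m₀ m₁ m₂ c₃ c₄ c₀ c₁ c₂ (by linarith)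
    tauto
  · have := gauss_relation_bound_of_min hP h₄ m₀ m₁ m₂ m₃ c₄ c₀ c₁ c₂ c₃ (by linarith)
    tauto

lemma exists_large_orient {q : Fin 5 → ℝ × ℝ}
    (h : ∀ i j k, i < j → j < k → 0 < orient (q i) (q j) (q k)) :
    ∃ i j k, i < j ∧ j < k ∧ (orient (q 0) (q 1) (q 2) + orient (q 0) (q 2) (q 3) +
      orient (q 0) (q 3) (q 4)) / √5 ≤ orient (q i) (q j) (q k) := by
  have e₀ := h 0 1 4 (by decide) (by decide)
  have e₁ := h 0 1 2 (by decide) (by decide)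
  have e₂ := h 1 2 3 (by decide) (by decide)
  have e₃ := h 2 3 4 (by decide) (by decide)
  have e₄ := h 0 3 4 (by decide) (by decide)
  have f₀ := h 0 2 3 (by decide) (by decide)
  have f₁ := h 1 3 4 (by decide) (by decide)
  have f₂ := h 0 2 4 (by decide) (by decide)
  have f₃ := h 0 1 3 (by decide) (by decide)
  have f₄ := h 1 2 4 (by decide) (by decide)
  set P := orient (q 0) (q 1) (q 2) + orient (q 0) (q 2) (q 3) + orient (q 0) (q 3) (q 4) with hP
  have r₀ : orient (q 0) (q 2) (q 3) = P - orient (q 0) (q 3) (q 4) - orient (q 0) (q 1) (q 2) := by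
    rw [hP]; ring
  have r₁ : orient (q 1) (q 3) (q 4) = P - orient (q 0) (q 1) (q 4) - orient (q 1) (q 2) (q 3) := by
    simp only [hP, orient]; ring
  have r₂ : orient (q 0) (q 2) (q 4) = P - orient (q 0) (q 1) (q 2) - orient (q 2) (q 3) (q 4) := by
    simp only [hP, orient]; ring
  have r₃ : orient (q 0) (q 1) (q 3) = P - orient (q 1) (q 2) (q 3) - orient (q 0) (q 3) (q 4) := by
    simp only [hP, orient]; ring
  have r₄ : orient (q 1) (q 2) (q 4) = P - orient (q 2) (q 3) (q 4) - orient (q 0) (q 1) (q 4) := by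
    simp only [hP, orient]; ring
  have hPpos : 0 < P := by positivity
  rcases gauss_relation_bound hPpos e₀.le e₂.le e₄.le e₁.le e₃.le (r₁ ▸ f₁) (r₃ ▸ f₃) (r₀ ▸ f₀)
    (r₂ ▸ f₂) (r₄ ▸ f₄) (by simp only [hP, orient]; ring) with H | H | H | H | H
  · exact ⟨1, 3, 4, by decide, by decide, r₁ ▸ H⟩
  · exact ⟨0, 1, 3, by decide, by decide, r₃ ▸ H⟩
  · exact ⟨0, 2, 3, by decide, by decide, H.trans r₀.ge⟩
  · exact ⟨0, 2, 4, by decide, by decide, r₂ ▸ H⟩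
  · exact ⟨1, 2, 4, by decide, by decide, r₄ ▸ H⟩

/-- Every convex pentagon contains a triangle on three of its vertices whose
area is at least `1/√5` times the area of the pentagon. -/
theorem pentagon_contains_large_triangle
    (p : Fin 5 → ℝ × ℝ) (hp : StrictConvexPos p) :
    ∃ s : Finset (Fin 5), s.card = 3 ∧
      (1 / Real.sqrt 5) * area (Set.range p) ≤ area (p '' ↑s) := by
  obtain ⟨π, hπ⟩ := exists_perm_orient_pos hp.1
  obtain ⟨i, j, k, hij, hjk, hle⟩ := exists_large_orient (q := p ∘ π) hπ
  have harea := area_le_fan (q := p ∘ π) hπ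
  rw [π.surjective.range_comp] at harea
  refine ⟨{π i, π j, π k}, Finset.card_eq_three.2 ⟨_, _, _, π.injective.ne hij.ne,
    π.injective.ne (hij.trans hjk).ne, π.injective.ne hjk.ne, rfl⟩, ?_⟩
  have himg : p '' ↑({π i, π j, π k} : Finset (Fin 5)) = {p (π i), p (π j), p (π k)} := by
    simp [Set.image_insert_eq]
  rw [himg, area_triple, abs_of_pos (hπ i j k hij hjk)]
  refine (mul_le_mul_of_nonneg_left harea (by positivity)).trans ?_
  rw [← mul_assoc, one_div_mul_eq_div]
  exact mul_le_mul_of_nonneg_right hle (area_nonneg _)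
end

section
/- In a regular hexagon, every quadrilateral whose vertices are four of the hexagon's six vertices has area at most 2/3 of the area of the hexagon, and some such quadrilateral attains this ratio. (Hence f_6(4) = 2/3.) -/
open MeasureTheory

/-- The area between the graphs of two continuous functions over an interval, graphs included. -/
lemma volume_closed_region_between_s9 {f g : ℝ → ℝ} (hf : Continuous f) (hg : Continuous g)
    {a b : ℝ} (hab : a ≤ b) (hfg : ∀ x ∈ Set.Icc a b, f x ≤ g x) :
    volume {v : ℝ × ℝ | v.1 ∈ Set.Icc a b ∧ v.2 ∈ Set.Icc (f v.1) (g v.1)} =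
      ENNReal.ofReal (∫ x in a..b, (g x - f x)) := by
  have hclosed : IsClosed {v : ℝ × ℝ | v.1 ∈ Set.Icc a b ∧ v.2 ∈ Set.Icc (f v.1) (g v.1)} :=
    (isClosed_Icc.preimage continuous_fst).inter
      ((isClosed_le (hf.comp continuous_fst) continuous_snd).inter
        (isClosed_le continuous_snd (hg.comp continuous_fst)))
  have hslice : ∀ x : ℝ, volume (Prod.mk x ⁻¹'
      {v : ℝ × ℝ | v.1 ∈ Set.Icc a b ∧ v.2 ∈ Set.Icc (f v.1) (g v.1)}) =
      (Set.Icc a b).indicator (fun x => ENNReal.ofReal (g x - f x)) x := by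
    intro x
    by_cases hx : x ∈ Set.Icc a b
    · rw [Set.indicator_of_mem hx, ← Real.volume_Icc]
      congr 1
      ext y
      simp only [Set.mem_preimage, Set.mem_ofPred_eq, hx, true_and]
    · rw [Set.indicator_of_notMem hx]
      convert measure_empty (μ := (volume : Measure ℝ))
      exact Set.eq_empty_of_forall_notMem fun y hy => hx hy.1
  rw [Measure.volume_eq_prod, Measure.prod_apply hclosed.measurableSet, lintegral_congr hslice,
    lintegral_indicator measurableSet_Icc, intervalIntegral.integral_of_le hab,
    ← integral_Icc_eq_integral_Ioc, ofReal_integral_eq_lintegral_ofReal]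
  · exact (hg.sub hf).continuousOn.integrableOn_Icc
  · exact (ae_restrict_iff' measurableSet_Icc).2
      (Filter.Eventually.of_forall fun x hx => sub_nonneg.2 (hfg x hx))

lemma convex_closed_region_between {f g : ℝ → ℝ} {s : Set ℝ} (hf : ConvexOn ℝ s f)
    (hg : ConcaveOn ℝ s g) : Convex ℝ {v : ℝ × ℝ | v.1 ∈ s ∧ v.2 ∈ Set.Icc (f v.1) (g v.1)} := by
  convert hf.convex_epigraph.inter hg.convex_hypograph using 1
  ext v
  simp only [Set.mem_ofPred_eq, Set.mem_inter_iff, Set.mem_Icc]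
  tauto

lemma convexOn_affine (m b : ℝ) {s : Set ℝ} (hs : Convex ℝ s) :
    ConvexOn ℝ s fun x => m * x + b := by
  refine ⟨hs, fun x _ y _ t u _ _ htu => le_of_eq ?_⟩
  simp only [smul_eq_mul]
  linear_combination -b * htu

lemma concaveOn_affine (m b : ℝ) {s : Set ℝ} (hs : Convex ℝ s) :
    ConcaveOn ℝ s fun x => m * x + b := by
  refine ⟨hs, fun x _ y _ t u _ _ htu => le_of_eq ?_⟩
  simp only [smul_eq_mul]
  linear_combination b * htu

lemma area_le_integral {f g : ℝ → ℝ} (hf : Continuous f) (hg : Continuous g) {a b : ℝ}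
    (hab : a ≤ b) (hfg : ∀ x ∈ Set.Icc a b, f x ≤ g x) (hfc : ConvexOn ℝ (Set.Icc a b) f)
    (hgc : ConcaveOn ℝ (Set.Icc a b) g) {S : Set (ℝ × ℝ)}
    (hS : S ⊆ {v : ℝ × ℝ | v.1 ∈ Set.Icc a b ∧ v.2 ∈ Set.Icc (f v.1) (g v.1)}) :
    area S ≤ ∫ x in a..b, (g x - f x) := by
  refine ENNReal.toReal_le_of_le_ofReal (intervalIntegral.integral_nonneg hab fun x hx =>
    sub_nonneg.2 (hfg x hx)) ?_
  rw [← volume_closed_region_between_s9 hf hg hab hfg]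
  exact measure_mono (convexHull_min hS (convex_closed_region_between hfc hgc))

lemma integral_le_area {f g : ℝ → ℝ} (hf : Continuous f) (hg : Continuous g) {a b : ℝ}
    (hab : a ≤ b) (hfg : ∀ x ∈ Set.Icc a b, f x ≤ g x) {S : Set (ℝ × ℝ)} (hfin : S.Finite)
    (hS : {v : ℝ × ℝ | v.1 ∈ Set.Icc a b ∧ v.2 ∈ Set.Icc (f v.1) (g v.1)} ⊆ convexHull ℝ S) :
    ∫ x in a..b, (g x - f x) ≤ area S := by
  refine (ENNReal.ofReal_le_iff_le_toReal
    (hfin.isCompact_convexHull (𝕜 := ℝ)).measure_lt_top.ne).1 ?_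
  rw [← volume_closed_region_between_s9 hf hg hab hfg]
  exact measure_mono hS

open scoped Pointwise in
lemma area_image_add_linearMap (c : ℝ × ℝ) (L : ℝ × ℝ →ₗ[ℝ] ℝ × ℝ) (S : Set (ℝ × ℝ)) :
    area ((fun v => c + L v) '' S) = |LinearMap.det L| * area S := by
  have h : (fun v => c + L v) '' S = c +ᵥ (L '' S) := by
    rw [← Set.image_vadd, Set.image_image]
    rfl
  rw [area, area, h, convexHull_vadd, measure_vadd, ← LinearMap.image_convexHull,
    Measure.addHaar_image_linearMap, ENNReal.toReal_mul, ENNReal.toReal_ofReal (abs_nonneg _)]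

lemma integral_abs_neg_one_one : ∫ x in (-1 : ℝ)..1, |x| = 1 := by
  have hi (a b : ℝ) : IntervalIntegrable (fun x : ℝ => |x|) volume a b :=
    continuous_abs.intervalIntegrable a b
  rw [← intervalIntegral.integral_add_adjacent_intervals (hi (-1) 0) (hi 0 1)]
  have h₁ : ∫ x in (-1 : ℝ)..0, |x| = ∫ x in (-1 : ℝ)..0, -x :=
    intervalIntegral.integral_congr fun x hx => by
      rw [Set.uIcc_of_le (by norm_num)] at hx
      exact abs_of_nonpos hx.2
  have h₂ : ∫ x in (0 : ℝ)..1, |x| = ∫ x in (0 : ℝ)..1, x :=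
    intervalIntegral.integral_congr fun x hx => by
      rw [Set.uIcc_of_le (by norm_num)] at hx
      exact abs_of_nonneg hx.1
  rw [h₁, h₂, intervalIntegral.integral_neg]
  norm_num

/-- The vertices of a hexagon that is an affine image of the regular one. -/
def latticeHexagon : Fin 6 → ℝ × ℝ :=
  ![(1, 0), (0, 1), (-1, 1), (-1, 0), (0, -1), (1, -1)]

lemma integral_hexagon_height :
    ∫ x in (-1 : ℝ)..1, (min (0 * x + 1) (-1 * x + 1) - max (0 * x + -1) (-1 * x + -1)) = 3 := by
  have h : ∀ x : ℝ, min (0 * x + 1) (-1 * x + 1) - max (0 * x + -1) (-1 * x + -1) = 2 - |x| := by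
    grind
  simp only [h]
  rw [intervalIntegral.integral_sub (by simp) (continuous_abs.intervalIntegrable _ _),
    integral_abs_neg_one_one]
  norm_num

lemma area_range_latticeHexagon : area (Set.range latticeHexagon) = 3 := by
  have hfg : ∀ x ∈ Set.Icc (-1 : ℝ) 1,
      max (0 * x + -1) (-1 * x + -1) ≤ min (0 * x + 1) (-1 * x + 1) := by
    grind
  apply le_antisymm <;> rw [← integral_hexagon_height]
  · refine area_le_integral (by fun_prop) (by fun_prop) (by norm_num) hfg
      ((convexOn_affine _ _ (convex_Icc _ _)).sup (convexOn_affine _ _ (convex_Icc _ _)))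
      ((concaveOn_affine _ _ (convex_Icc _ _)).inf (concaveOn_affine _ _ (convex_Icc _ _))) ?_
    rintro _ ⟨k, rfl⟩
    fin_cases k <;> norm_num [latticeHexagon]
  · refine integral_le_area (by fun_prop) (by fun_prop) (by norm_num) hfg
      (Set.finite_range _) ?_
    rintro ⟨x, y⟩ ⟨⟨hx₁, hx₂⟩, hy⟩
    simp only [Set.mem_Icc, max_le_iff, le_min_iff] at hx₁ hx₂ hy
    obtain ⟨⟨hy₁, hy₂⟩, hy₃, hy₄⟩ := hy
    have hmem (w : Fin 6 → ℝ) (hw : ∀ i, 0 ≤ w i) (hsum : ∑ i, w i = 1)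
        (hx : w 0 - w 2 - w 3 + w 5 = x) (hy : w 1 + w 2 - w 4 - w 5 = y) :
        (x, y) ∈ convexHull ℝ (Set.range latticeHexagon) := by
      convert (convex_convexHull ℝ _).sum_mem (fun i _ => hw i) hsum
        fun i _ => subset_convexHull ℝ _ (Set.mem_range_self (f := latticeHexagon) i) using 1
      ext <;> simp [Fin.sum_univ_six, latticeHexagon] <;> linarith
    rcases le_total 0 x with hx | hx <;> rcases le_total 0 y with hy | hy
    · apply hmem ![x + (1 - x - y) / 2, y, 0, (1 - x - y) / 2, 0, 0] <;>
        simp [Fin.forall_fin_succ, Fin.sum_univ_six] <;> grind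
    · rcases le_total 0 (x + y) with hxy | hxy
      · apply hmem ![x + y + (1 - x) / 2, 0, 0, (1 - x) / 2, 0, -y] <;>
          simp [Fin.forall_fin_succ, Fin.sum_univ_six] <;> grind
      · apply hmem ![(1 + y) / 2, 0, 0, (1 + y) / 2, -(x + y), x] <;>
          simp [Fin.forall_fin_succ, Fin.sum_univ_six] <;> grind
    · rcases le_total 0 (x + y) with hxy | hxy
      · apply hmem ![(1 - y) / 2, x + y, -x, (1 - y) / 2, 0, 0] <;>
          simp [Fin.forall_fin_succ, Fin.sum_univ_six] <;> grind
      · apply hmem ![(1 + x) / 2, 0, y, -(x + y) + (1 + x) / 2, 0, 0] <;>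
          simp [Fin.forall_fin_succ, Fin.sum_univ_six] <;> grind
    · apply hmem ![(1 + x + y) / 2, 0, 0, -x + (1 + x + y) / 2, -y, 0] <;>
        simp [Fin.forall_fin_succ, Fin.sum_univ_six] <;> grind

lemma area_latticeHexagon_trapezoid_le : area (latticeHexagon '' {0, 1, 2, 3}) ≤ 2 := by
  refine (area_le_integral (f := fun x => 0 * x + 0) (g := fun x => 0 * x + 1) (a := -1) (b := 1)
    (by fun_prop) (by fun_prop) (by norm_num) (by norm_num)
    (convexOn_affine _ _ (convex_Icc _ _)) (concaveOn_affine _ _ (convex_Icc _ _)) ?_).trans ?_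
  · rintro _ ⟨k, hk, rfl⟩
    rcases hk with rfl | rfl | rfl | rfl <;> simp [latticeHexagon]
  · norm_num

lemma area_latticeHexagon_kite_le : area (latticeHexagon '' {0, 2, 4, 5}) ≤ 2 := by
  refine (area_le_integral (f := fun x => max (0 * x + -1) (-2 * x + -1))
    (g := fun x => -1 / 2 * x + 1 / 2) (a := -1) (b := 1)
    (by fun_prop) (by fun_prop) (by norm_num) (by grind)
    ((convexOn_affine _ _ (convex_Icc _ _)).sup (convexOn_affine _ _ (convex_Icc _ _)))
    (concaveOn_affine _ _ (convex_Icc _ _)) ?_).trans ?_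
  · rintro _ ⟨k, hk, rfl⟩
    rcases hk with rfl | rfl | rfl | rfl <;> simp [latticeHexagon] <;> norm_num
  · have h : ∀ x : ℝ, -1 / 2 * x + 1 / 2 - max (0 * x + -1) (-2 * x + -1) =
        3 / 2 + 1 / 2 * x - |x| := by
      grind
    simp only [h]
    rw [intervalIntegral.integral_sub (Continuous.intervalIntegrable (by fun_prop) _ _)
      (continuous_abs.intervalIntegrable _ _), integral_abs_neg_one_one,
      intervalIntegral.integral_add (by simp)
        (Continuous.intervalIntegrable (by fun_prop) _ _), intervalIntegral.integral_const_mul]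
    norm_num

lemma area_latticeHexagon_parallelogram : area (latticeHexagon '' {0, 2, 3, 5}) = 2 := by
  have hint : ∫ x in (-1 : ℝ)..1, (-1 / 2 * x + 1 / 2 - (-1 / 2 * x + -1 / 2)) = 2 := by
    ring_nf
    norm_num
  apply le_antisymm <;> rw [← hint]
  · refine area_le_integral (by fun_prop) (by fun_prop) (by norm_num) (by grind)
      (convexOn_affine _ _ (convex_Icc _ _)) (concaveOn_affine _ _ (convex_Icc _ _)) ?_
    rintro _ ⟨k, hk, rfl⟩
    rcases hk with rfl | rfl | rfl | rfl <;> simp [latticeHexagon] <;> norm_num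
  · refine integral_le_area (by fun_prop) (by fun_prop) (by norm_num) (by grind)
      (Set.toFinite _) ?_
    rintro ⟨x, y⟩ ⟨⟨hx₁, hx₂⟩, hy₁, hy₂⟩
    dsimp only at hx₁ hx₂ hy₁ hy₂
    have hC := convex_convexHull ℝ (latticeHexagon '' {0, 2, 3, 5})
    have hmem : ∀ i ∈ ({0, 2, 3, 5} : Set (Fin 6)),
        latticeHexagon i ∈ convexHull ℝ (latticeHexagon '' {0, 2, 3, 5}) :=
      fun i hi => subset_convexHull ℝ _ (Set.mem_image_of_mem _ hi)
    have hs₀ : 0 ≤ (1 + x) / 2 := by linarith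
    have hs₁ : 0 ≤ (1 - x) / 2 := by linarith
    have ht₀ : 0 ≤ (1 + x + 2 * y) / 2 := by linarith
    have ht₁ : 0 ≤ (1 - x - 2 * y) / 2 := by linarith
    have htop := hC (hmem 0 (by simp)) (hmem 2 (by simp)) hs₀ hs₁ (by ring)
    have hbot := hC (hmem 5 (by simp)) (hmem 3 (by simp)) hs₀ hs₁ (by ring)
    convert hC htop hbot ht₀ ht₁ (by ring) using 1
    ext <;> simp [latticeHexagon] <;> ring

/-- Hexagons whose vertices satisfy the linear recurrence of a regular hexagon with center `c`
are affine images of the lattice hexagon. -/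
lemma exists_area_image_eq {c : ℝ × ℝ} {p : Fin 6 → ℝ × ℝ}
    (hp : ∀ k, p k + p (k + 2) = p (k + 1) + c) :
    ∃ d : ℝ, 0 ≤ d ∧ ∀ t : Set (Fin 6), area (p '' t) = d * area (latticeHexagon '' t) := by
  let L : ℝ × ℝ →ₗ[ℝ] ℝ × ℝ :=
    (LinearMap.fst ℝ ℝ ℝ).smulRight (p 0 - c) + (LinearMap.snd ℝ ℝ ℝ).smulRight (p 1 - c)
  refine ⟨|LinearMap.det L|, abs_nonneg _, fun t => ?_⟩
  have hpL : p = fun k => c + L (latticeHexagon k) := by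
    have h0 := hp 0
    have h1 := hp 1
    have h2 := hp 2
    have h3 := hp 3
    norm_num [Prod.ext_iff] at h0 h1 h2 h3
    ext k <;> fin_cases k <;> simp [L, latticeHexagon] <;> grind
  conv_lhs => rw [hpL, ← Set.image_image (fun v => c + L v) latticeHexagon]
  rw [area_image_add_linearMap]

lemma Fin.exists_image_add_of_card_eq_four :
    ∀ s : Finset (Fin 6), s.card = 4 → ∃ k : Fin 6,
      s = ({0, 1, 2, 3} : Finset (Fin 6)).image (· + k) ∨
      s = ({0, 2, 4, 5} : Finset (Fin 6)).image (· + k) ∨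
      s = ({0, 2, 3, 5} : Finset (Fin 6)).image (· + k) := by
  decide

lemma area_image_le_of_recurrence {c : ℝ × ℝ} {p : Fin 6 → ℝ × ℝ}
    (hp : ∀ k, p k + p (k + 2) = p (k + 1) + c) {s : Finset (Fin 6)} (hs : s.card = 4) :
    area (p '' ↑s) ≤ (2 / 3) * area (Set.range p) := by
  obtain ⟨k, hk⟩ := Fin.exists_image_add_of_card_eq_four s hs
  obtain ⟨d, hd, h⟩ := exists_area_image_eq (p := fun i => p (i + k)) (c := c) fun i => by
    simpa only [add_right_comm] using hp (i + k)
  have hrange : area (Set.range p) = d * 3 := by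
    rw [← area_range_latticeHexagon, ← Set.image_univ (f := latticeHexagon), ← h, Set.image_univ]
    exact congrArg area ((Equiv.addRight k).surjective.range_comp p).symm
  have himage (t : Finset (Fin 6)) :
      area (p '' ↑(t.image (· + k))) = d * area (latticeHexagon '' ↑t) := by
    rw [← h, Finset.coe_image, Set.image_image]
  have hle : ∀ x : ℝ, x ≤ 2 → d * x ≤ 2 / 3 * (d * 3) := fun x hx => by nlinarith
  rw [hrange]
  rcases hk with rfl | rfl | rfl <;> rw [himage] <;> apply hle <;> push_cast
  · exact area_latticeHexagon_trapezoid_le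
  · exact area_latticeHexagon_kite_le
  · exact area_latticeHexagon_parallelogram.le

lemma Real.cos_sin_add_pi_div_three (x : ℝ) :
    Real.cos x + Real.cos (x + 2 * (Real.pi / 3)) = Real.cos (x + Real.pi / 3) ∧
    Real.sin x + Real.sin (x + 2 * (Real.pi / 3)) = Real.sin (x + Real.pi / 3) := by
  rw [Real.cos_add, Real.sin_add, Real.cos_add, Real.sin_add, Real.cos_two_mul, Real.sin_two_mul,
    Real.cos_pi_div_three, Real.sin_pi_div_three]
  constructor <;> ring

/-- In a regular hexagon, every quadrilateral on four of the six vertices has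
area at most `2/3` of the area of the hexagon, and some quadrilateral attains
this ratio. -/
theorem regular_hexagon_quadrilateral_ratio
    (c : ℝ × ℝ) (R θ : ℝ) (hR : 0 < R) (p : Fin 6 → ℝ × ℝ)
    (hp : ∀ k : Fin 6, p k =
      (c.1 + R * Real.cos (2 * Real.pi * (k.val : ℝ) / 6 + θ),
       c.2 + R * Real.sin (2 * Real.pi * (k.val : ℝ) / 6 + θ))) :
    (∀ s : Finset (Fin 6), s.card = 4 →
      area (p '' ↑s) ≤ (2 / 3) * area (Set.range p)) ∧
    (∃ s : Finset (Fin 6), s.card = 4 ∧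
      area (p '' ↑s) = (2 / 3) * area (Set.range p)) := by
  have hrec : ∀ k, p k + p (k + 2) = p (k + 1) + c := by
    have hmod (n : ℕ) : 2 * Real.pi * (n : ℝ) / 6 + θ =
        2 * Real.pi * ((n % 6 : ℕ) : ℝ) / 6 + θ + (n / 6 : ℕ) * (2 * Real.pi) := by
      have h : (n : ℝ) = (n % 6 : ℕ) + 6 * (n / 6 : ℕ) := by
        exact_mod_cast (Nat.mod_add_div n 6).symm
      linear_combination Real.pi / 3 * h
    have hshift (k j : Fin 6) : p (k + j) =
        (c.1 + R * Real.cos (2 * Real.pi * k.val / 6 + θ + j.val * (Real.pi / 3)),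
          c.2 + R * Real.sin (2 * Real.pi * k.val / 6 + θ + j.val * (Real.pi / 3))) := by
      have h : 2 * Real.pi * k.val / 6 + θ + j.val * (Real.pi / 3) =
          2 * Real.pi * ((k.val + j.val : ℕ) : ℝ) / 6 + θ := by
        push_cast
        ring
      rw [h, hmod, Real.cos_add_nat_mul_two_pi, Real.sin_add_nat_mul_two_pi, ← Fin.val_add, hp]
    intro k
    obtain ⟨hcos, hsin⟩ := Real.cos_sin_add_pi_div_three (2 * Real.pi * k.val / 6 + θ)
    rw [hshift, hshift, hp]
    ext
    · simp
      linear_combination R * hcos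
    · simp
      linear_combination R * hsin
  refine ⟨fun s hs => area_image_le_of_recurrence hrec hs, {0, 2, 3, 5}, rfl, ?_⟩
  obtain ⟨d, -, h⟩ := exists_area_image_eq hrec
  rw [h, ← Set.image_univ, h, Set.image_univ, area_range_latticeHexagon]
  push_cast
  rw [area_latticeHexagon_parallelogram]
  ring
end

section
/- Let ABCDE be a convex pentagon (vertices in strictly convex position, labeled in cyclic order) in which the area of triangle DEA is at most the minimum of the areas of triangles CDE and EAB. Then the area of triangle DEA is at most the minimum of the areas of triangles ABD and ACD. -/
open MeasureTheory

/-- The cross product (twice the signed area) of the triangle `a b c`. -/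
def Cross (a b c : ℝ × ℝ) : ℝ :=
  (b.1 - a.1) * (c.2 - a.2) - (b.2 - a.2) * (c.1 - a.1)

/-- The vertices `p 0, p 1, …, p (n-1)` are labeled in cyclic order around their
convex hull: all remaining vertices lie strictly on one and the same side of
each directed edge `p i → p (i+1)`. -/
def ConvexCyclic {n : ℕ} [NeZero n] (p : Fin n → ℝ × ℝ) : Prop :=
  (∀ i j : Fin n, j ≠ i → j ≠ i + 1 → 0 < Cross (p i) (p (i + 1)) (p j)) ∨
  (∀ i j : Fin n, j ≠ i → j ≠ i + 1 → Cross (p i) (p (i + 1)) (p j) < 0)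

open scoped Pointwise in
/-- The area of a triangle is proportional to the absolute value of its cross product. -/
theorem area_triangle_eq (a b c : ℝ × ℝ) :
    area {a, b, c} = |Cross a b c| * area {(0, 0), (1, 0), (0, 1)} := by
  let f : ℝ × ℝ →ₗ[ℝ] ℝ × ℝ :=
    Matrix.toLin (Module.Basis.finTwoProd ℝ) (Module.Basis.finTwoProd ℝ)
      !![b.1 - a.1, c.1 - a.1; b.2 - a.2, c.2 - a.2]
  have hdet : LinearMap.det f = Cross a b c := by
    simp only [f, LinearMap.det_toLin, Matrix.det_fin_two_of, Cross]
    ring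
  have himage : ({a, b, c} : Set (ℝ × ℝ)) =
      a +ᵥ (f '' {(0, 0), (1, 0), (0, 1)}) := by
    simp [f, Set.image_insert_eq, ← Set.image_vadd, Matrix.toLin_finTwoProd_apply, Prod.add_def]
  unfold area
  rw [himage, convexHull_vadd, ← f.image_convexHull, measure_vadd,
    Measure.addHaar_image_linearMap, hdet, ENNReal.toReal_mul,
    ENNReal.toReal_ofReal (abs_nonneg _)]

/-- Swapping the coordinates reverses the orientation of a triangle. -/
theorem Cross_swap (a b c : ℝ × ℝ) : Cross a.swap b.swap c.swap = -Cross a b c := by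
  simp only [Cross, Prod.fst_swap, Prod.snd_swap]
  ring

/-- The comparison of cross products in a positively oriented convex pentagon. -/
theorem Cross_small_ear {A B C D E : ℝ × ℝ}
    (hABC : 0 < Cross A B C) (hBCD : 0 < Cross B C D) (hDEA : 0 < Cross D E A)
    (hEAC : 0 < Cross E A C) (hDEB : 0 < Cross D E B)
    (hC : Cross D E A ≤ Cross C D E) (hB : Cross D E A ≤ Cross E A B) :
    Cross D E A ≤ Cross A B D ∧ Cross D E A ≤ Cross A C D := by
  have h₁ : Cross D E A * Cross A B C =
      (Cross D E B - Cross D E A) * Cross E A C -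
        Cross E A B * (Cross C D E - Cross D E A) := by
    unfold Cross; ring
  have h₂ : Cross D E A * Cross B C D =
      Cross D E B * (Cross E A C - Cross D E A) -
        Cross C D E * (Cross E A B - Cross D E A) := by
    unfold Cross; ring
  have h₃ : Cross A B D = Cross D E B + Cross E A B - Cross D E A := by
    unfold Cross; ring
  have h₄ : Cross A C D = Cross C D E + Cross E A C - Cross D E A := by
    unfold Cross; ring
  have hDEB' : 0 < Cross D E B - Cross D E A := by
    refine pos_of_mul_pos_left ?_ hEAC.le
    nlinarith [mul_pos hDEA hABC, mul_nonneg (hDEA.le.trans hB) (sub_nonneg.2 hC)]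
  have hEAC' : 0 < Cross E A C - Cross D E A := by
    refine pos_of_mul_pos_right ?_ hDEB.le
    nlinarith [mul_pos hDEA hBCD, mul_nonneg (hDEA.le.trans hC) (sub_nonneg.2 hB)]
  constructor <;> linarith

/-- The comparison of areas in a positively oriented convex pentagon. -/
theorem abs_Cross_small_ear {A B C D E : ℝ × ℝ}
    (h : ∀ i j : Fin 5, j ≠ i → j ≠ i + 1 →
      0 < Cross (![A, B, C, D, E] i) (![A, B, C, D, E] (i + 1)) (![A, B, C, D, E] j))
    (hC : |Cross D E A| ≤ |Cross C D E|) (hB : |Cross D E A| ≤ |Cross E A B|) :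
    |Cross D E A| ≤ |Cross A B D| ∧ |Cross D E A| ≤ |Cross A C D| := by
  have hABC : 0 < Cross A B C := h 0 2 (by decide) (by decide)
  have hBCD : 0 < Cross B C D := h 1 3 (by decide) (by decide)
  have hCDE : 0 < Cross C D E := h 2 4 (by decide) (by decide)
  have hDEA : 0 < Cross D E A := h 3 0 (by decide) (by decide)
  have hDEB : 0 < Cross D E B := h 3 1 (by decide) (by decide)
  have hEAB : 0 < Cross E A B := h 4 1 (by decide) (by decide)
  have hEAC : 0 < Cross E A C := h 4 2 (by decide) (by decide)
  rw [abs_of_pos hDEA] at hC hB ⊢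
  rw [abs_of_pos hCDE] at hC
  rw [abs_of_pos hEAB] at hB
  obtain ⟨h₁, h₂⟩ := Cross_small_ear hABC hBCD hDEA hEAC hDEB hC hB
  exact ⟨h₁.trans (le_abs_self _), h₂.trans (le_abs_self _)⟩

/-- If in a convex pentagon `ABCDE` the ear `DEA` has area at most those of the
ears `CDE` and `EAB`, then its area is also at most those of the triangles
`ABD` and `ACD`. -/
theorem pentagon_small_ear_lemma
    (A B C D E : ℝ × ℝ)
    (hp : StrictConvexPos ![A, B, C, D, E])
    (hcyc : ConvexCyclic ![A, B, C, D, E])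
    (hmin : area {D, E, A} ≤ min (area {C, D, E}) (area {E, A, B})) :
    area {D, E, A} ≤ min (area {A, B, D}) (area {A, C, D}) := by
  have hκ : 0 ≤ area {(0, 0), (1, 0), (0, 1)} := ENNReal.toReal_nonneg
  simp only [area_triangle_eq D E A, area_triangle_eq C D E, area_triangle_eq E A B,
    area_triangle_eq A B D, area_triangle_eq A C D, le_min_iff] at hmin ⊢
  obtain hκ | hκ := hκ.eq_or_lt
  · simp [← hκ]
  simp only [mul_le_mul_iff_left₀ hκ] at hmin ⊢
  obtain h | h := hcyc
  · exact abs_Cross_small_ear h hmin.1 hmin.2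
  · have hswap : ∀ i, ![A.swap, B.swap, C.swap, D.swap, E.swap] i =
        (![A, B, C, D, E] i).swap := by
      intro i
      fin_cases i <;> rfl
    have := abs_Cross_small_ear (A := A.swap) (B := B.swap) (C := C.swap) (D := D.swap)
      (E := E.swap) (fun i j h₁ h₂ => by
        rw [hswap, hswap, hswap, Cross_swap]
        exact neg_pos.2 (h i j h₁ h₂))
    simp only [Cross_swap, abs_neg] at this
    exact this hmin.1 hmin.2
end
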